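/- arXiv:2210.05120 — 3 statements merged into one kernel-verified Lean document; each statement's English description precedes it below -/
import Mathlib

section
/- Let A and B be stably equivalent Artin algebras, i.e., their stable module categories modulo projectives are equivalent as additive categories. Then ed(A) = ed(B). -/
universe u

open CategoryTheory

namespace Paper

variable (A : Type u) [Ring A]

/-- `X` belongs to `add 𝒮`: it is a direct summand of a finite direct sum of members of `𝒮`. -/
def memAdd (S : Set (ModuleCat.{u} A)) (X : ModuleCat.{u} A) : Prop :=
  ∃ (n : ℕ) (M : Fin n → ModuleCat.{u} A) (Y : ModuleCat.{u} A),
    (∀ i, M i ∈ S) ∧ Nonempty ((X × Y) ≃ₗ[A] ((i : Fin n) → M i))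

/-- `add T` for a single module `T`. -/
def addOf (T : ModuleCat.{u} A) : Set (ModuleCat.{u} A) :=
  {X | memAdd A {T} X}

/-- `0 → X → Y → Z → 0` is a short exact sequence. -/
def IsSES {X Y Z : ModuleCat.{u} A} (f : X →ₗ[A] Y) (g : Y →ₗ[A] Z) : Prop :=
  Function.Injective f ∧ Function.Surjective g ∧ LinearMap.range f = LinearMap.ker g

/-- The extension product `𝒮 • 𝒯` of two classes of modules. -/
def bullet (S T : Set (ModuleCat.{u} A)) : Set (ModuleCat.{u} A) :=
  {X | memAdd A {W | Module.Finite A W ∧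
    ∃ (T₁ T₂ : ModuleCat.{u} A) (f : T₁ →ₗ[A] W) (g : W →ₗ[A] T₂),
      T₁ ∈ S ∧ T₂ ∈ T ∧ IsSES A f g} X}

/-- `[T]ₙ`. -/
def bracket (T : ModuleCat.{u} A) : ℕ → Set (ModuleCat.{u} A)
  | 0 => {X | Subsingleton X}
  | 1 => addOf A T
  | (n+2) => bullet A (addOf A T) (bracket T (n+1))

/-- The extension dimension of `A`. -/
noncomputable def extDim : ℕ∞ :=
  sInf {d : ℕ∞ | ∃ n : ℕ, d = n ∧ ∃ T : ModuleCat.{u} A, Module.Finite A T ∧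
    ∀ X : ModuleCat.{u} A, Module.Finite A X → X ∈ bracket A T (n + 1)}

/-- There is an exact sequence `0 → M_n → ⋯ → M_0 → X → 0` with all `M_i ∈ add M`. -/
def ResLen (M : ModuleCat.{u} A) : ModuleCat.{u} A → ℕ → Prop
  | X, 0 => X ∈ addOf A M
  | X, (n+1) => ∃ (M₀ : ModuleCat.{u} A) (g : M₀ →ₗ[A] X),
      M₀ ∈ addOf A M ∧ Function.Surjective g ∧
        ResLen M (ModuleCat.of A (LinearMap.ker g)) n

/-- `M`-wrd(X) ≤ n : there is an exact sequence `0 → M_n → ⋯ → M_0 → X ⊕ Y → 0`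
with all `M_i ∈ add M`. -/
def wrdLE (M X : ModuleCat.{u} A) (n : ℕ) : Prop :=
  ∃ Y : ModuleCat.{u} A, Module.Finite A Y ∧ ResLen A M (ModuleCat.of A (X × Y)) n

/-- The weak `M`-resolution dimension of `X`. -/
noncomputable def wrdMod (M X : ModuleCat.{u} A) : ℕ∞ :=
  sInf {d : ℕ∞ | ∃ n : ℕ, d = n ∧ wrdLE A M X n}

/-- The weak `M`-resolution dimension of the algebra `A`. -/
noncomputable def wrdAlg (M : ModuleCat.{u} A) : ℕ∞ :=
  sSup {d : ℕ∞ | ∃ X : ModuleCat.{u} A, Module.Finite A X ∧ d = wrdMod A M X}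

/-- The weak resolution dimension of `A`. -/
noncomputable def wrd : ℕ∞ :=
  sInf {d : ℕ∞ | ∃ M : ModuleCat.{u} A, Module.Finite A M ∧ d = wrdAlg A M}

end Paper

open CategoryTheory Limits
open scoped ZeroObject

namespace Paper
variable (A : Type u) [Ring A]

/-- `f` factors through a projective module. -/
def FactorsThruProj {X Y : ModuleCat.{u} A} (f : X ⟶ Y) : Prop :=
  ∃ (P : ModuleCat.{u} A) (_ : Projective P) (g : X ⟶ P) (h : P ⟶ Y), f = g ≫ h

/-- The subgroup of homomorphisms factoring through a projective module. -/
def projHoms (X Y : ModuleCat.{u} A) : AddSubgroup (X ⟶ Y) where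
  carrier := {f | FactorsThruProj A f}
  zero_mem' := ⟨0, inferInstance, 0, 0, by simp⟩
  add_mem' := by
    rintro f₁ f₂ ⟨P₁, h₁, g₁, k₁, rfl⟩ ⟨P₂, h₂, g₂, k₂, rfl⟩
    haveI := h₁; haveI := h₂
    exact ⟨P₁ ⊞ P₂, inferInstance, biprod.lift g₁ g₂, biprod.desc k₁ k₂,
      by rw [biprod.lift_desc]⟩
  neg_mem' := by
    rintro f ⟨P, hP, g, h, rfl⟩
    exact ⟨P, hP, -g, h, by simp⟩

lemma comp_mem_projHoms {X Y Z : ModuleCat.{u} A} (u : X ⟶ Y) {f : Y ⟶ Z}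
    (hf : f ∈ projHoms A Y Z) : u ≫ f ∈ projHoms A X Z := by
  obtain ⟨P, hP, g, h, rfl⟩ := hf
  exact ⟨P, hP, u ≫ g, h, by simp⟩

lemma mem_projHoms_comp {X Y Z : ModuleCat.{u} A} {f : X ⟶ Y} (v : Y ⟶ Z)
    (hf : f ∈ projHoms A X Y) : f ≫ v ∈ projHoms A X Z := by
  obtain ⟨P, hP, g, h, rfl⟩ := hf
  exact ⟨P, hP, g, h ≫ v, by simp⟩

/-- Objects of the stable module category: finitely generated `A`-modules. -/
structure StObj where
  M : ModuleCat.{u} A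
  fin : Module.Finite A M

/-- The stable module category of `A` modulo projectives: morphisms are
homomorphisms modulo those factoring through a projective module. -/
instance : Category (StObj A) where
  Hom X Y := (X.M ⟶ Y.M) ⧸ projHoms A X.M Y.M
  id X := QuotientAddGroup.mk (𝟙 X.M)
  comp {X Y Z} := Quotient.map₂' (· ≫ ·) (by
    intro a b hab c d hcd
    rw [QuotientAddGroup.leftRel_apply] at hab hcd ⊢
    have : -(a ≫ c) + b ≫ d = b ≫ (-c + d) + (-a + b) ≫ c := by
      simp [Preadditive.comp_add, Preadditive.add_comp]
      abel
    rw [this]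
    exact (projHoms A X.M Z.M).add_mem (comp_mem_projHoms A b hcd)
      (mem_projHoms_comp A c hab))
  id_comp := by
    rintro X Y ⟨f⟩
    exact congrArg (Quotient.mk _) (Category.id_comp f)
  comp_id := by
    rintro X Y ⟨f⟩
    exact congrArg (Quotient.mk _) (Category.comp_id f)
  assoc := by
    rintro W X Y Z ⟨f⟩ ⟨g⟩ ⟨h⟩
    exact congrArg (Quotient.mk _) (Category.assoc f g h)

/-- The additive structure on the stable hom groups. -/
instance (X Y : StObj A) : AddCommGroup (X ⟶ Y) :=
  inferInstanceAs (AddCommGroup ((X.M ⟶ Y.M) ⧸ projHoms A X.M Y.M))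

end Paper

namespace Paper

/-- Over an algebra `A` over a Noetherian ring `k`, homomorphisms from a module of finite length
into an essential extension of a `k`-finite module form a Noetherian `k`-module. -/
lemma isNoetherian_hom_of_essential (k : Type u) [CommRing k] [IsNoetherianRing k] {A : Type u}
    [Ring A] [Algebra k A] {N : Type u} [AddCommGroup N] [Module A N] [Module k N]
    [IsScalarTower k A N] (T : Submodule A N) [IsNoetherian k T]
    (hT : ∀ U : Submodule A N, Disjoint U T → U = ⊥)
    {L : Type u} [AddCommGroup L] [Module A L] (hL : IsFiniteLength A L) :
    have : SMulCommClass A k N := IsScalarTower.to_smulCommClass'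
    IsNoetherian k (L →ₗ[A] N) := by
  have : SMulCommClass A k N := IsScalarTower.to_smulCommClass'
  induction hL with
  | of_subsingleton => infer_instance
  | @of_simple_quotient M _ _ M' _ _ ih =>
    have hsimple : IsNoetherian k ((M ⧸ M') →ₗ[A] N) := by
      have := IsSimpleModule.nontrivial A (M ⧸ M')
      obtain ⟨s, hs⟩ := exists_ne (0 : M ⧸ M')
      have hspan : ∀ x : M ⧸ M', ∃ a : A, a • s = x :=
        fun x => IsSimpleModule.toSpanSingleton_surjective A hs x
      have hmem : ∀ f : (M ⧸ M') →ₗ[A] N, f s ∈ T := by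
        intro f
        by_contra hf
        have hker : LinearMap.range f = ⊥ := by
          refine hT _ (Submodule.disjoint_def.2 ?_)
          rintro _ ⟨x, rfl⟩ hx
          by_contra hne
          have hx0 : x ≠ 0 := fun h => hne (by simp [h])
          obtain ⟨a, rfl⟩ := IsSimpleModule.toSpanSingleton_surjective A hx0 s
          exact hf (by simpa using T.smul_mem a hx)
        exact hf (by rw [LinearMap.range_eq_bot.1 hker]; simp)
      let ev : ((M ⧸ M') →ₗ[A] N) →ₗ[k] T :=
        { toFun := fun f => ⟨f s, hmem f⟩
          map_add' := fun f g => rfl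
          map_smul' := fun c f => rfl }
      refine isNoetherian_of_injective ev fun f g hfg => ?_
      ext1
      ext x
      obtain ⟨a, ha⟩ := hspan (M'.mkQ x)
      have h : f s = g s := congrArg Subtype.val hfg
      simp only [LinearMap.comp_apply, ← ha, map_smul, h]
    let p : ((M ⧸ M') →ₗ[A] N) →ₗ[k] (M →ₗ[A] N) :=
      { toFun := fun f => f ∘ₗ M'.mkQ
        map_add' := fun f g => rfl
        map_smul' := fun c f => rfl }
    let r : (M →ₗ[A] N) →ₗ[k] (M' →ₗ[A] N) :=
      { toFun := fun f => f ∘ₗ M'.subtype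
        map_add' := fun f g => rfl
        map_smul' := fun c f => rfl }
    refine isNoetherian_of_range_eq_ker p r (le_antisymm ?_ ?_)
    · rintro _ ⟨f, rfl⟩
      ext x
      have : M'.mkQ x = 0 := by simp
      exact (congrArg f this).trans (map_zero f)
    · intro f hf
      refine ⟨M'.liftQ f fun x hx => ?_, by ext x; simp [p]⟩
      exact LinearMap.congr_fun (LinearMap.mem_ker.1 hf) ⟨x, hx⟩

/-- An essential extension of a finitely generated module over an Artin algebra is finitely
generated. -/
lemma finite_of_essential (k : Type u) [CommRing k] [IsArtinianRing k] {A : Type u}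
    [Ring A] [Algebra k A] [Module.Finite k A] {N : Type u} [AddCommGroup N] [Module A N]
    (T : Submodule A N) [Module.Finite A T]
    (hT : ∀ U : Submodule A N, Disjoint U T → U = ⊥) : Module.Finite A N := by
  let : Module k N := Module.compHom N (algebraMap k A)
  have : IsScalarTower k A N := ⟨fun c a x => by
    rw [Algebra.smul_def, mul_smul]; rfl⟩
  have : SMulCommClass A k N := IsScalarTower.to_smulCommClass'
  have : Module.Finite k T := Module.Finite.trans A T
  have : IsNoetherian k T := isNoetherian_of_isNoetherianRing_of_finite k T
  have hA : IsFiniteLength A A := isFiniteLength_iff_isNoetherian_isArtinian.2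
    ⟨IsNoetherianRing.of_finite k A, IsArtinianRing.of_finite k A⟩
  have := isNoetherian_hom_of_essential k T hT hA
  have : IsNoetherian k N := isNoetherian_of_linearEquiv (LinearMap.ringLmapEquivSelf A k N)
  exact Module.Finite.of_restrictScalars_finite k A N

/-- Finitely generated modules over an Artin algebra embed into finitely generated injective
modules. -/
lemma exists_finite_injective (k : Type u) [CommRing k] [IsArtinianRing k] (A : Type u)
    [Ring A] [Algebra k A] [Module.Finite k A] (T : Type u) [AddCommGroup T] [Module A T]
    [Module.Finite A T] :
    ∃ (I : ModuleCat.{u} A) (i : T →ₗ[A] I),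
      Module.Finite A I ∧ Module.Injective A I ∧ Function.Injective i := by
  let J : ModuleCat.{u} A := Injective.under (ModuleCat.of A T)
  have : Injective (ModuleCat.of A J) := inferInstanceAs (Injective (Injective.under _))
  have : Module.Injective A J := Module.injective_module_of_injective_object A J
  let i₀ : T →ₗ[A] J := (Injective.ι (ModuleCat.of A T)).hom
  have hi₀ : Function.Injective i₀ := (ModuleCat.mono_iff_injective _).1 inferInstance
  obtain ⟨C, hC⟩ := zorn_le₀ {C : Submodule A J | Disjoint C (LinearMap.range i₀)} (by
    intro c hc hchain
    refine ⟨sSup c, ?_, fun z hz => le_sSup hz⟩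
    exact (hchain.directedOn.disjoint_sSup_left).2 fun b hb => hc hb)
  have hdisj : Disjoint C (LinearMap.range i₀) := hC.prop
  let i : T →ₗ[A] (J ⧸ C) := C.mkQ ∘ₗ i₀
  have hi : Function.Injective i := by
    refine (injective_iff_map_eq_zero i).2 fun t ht => hi₀ ?_
    rw [map_zero]
    exact Submodule.disjoint_def.1 hdisj _ ((Submodule.Quotient.mk_eq_zero C).1 ht) ⟨t, rfl⟩
  have hess : ∀ U : Submodule A (J ⧸ C), Disjoint U (LinearMap.range i) → U = ⊥ := by
    intro U hU
    have hle : U.comap C.mkQ ≤ C := by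
      refine hC.le_of_ge (y := U.comap C.mkQ) ?_ (C.le_comap_mkQ U)
      refine Submodule.disjoint_def.2 ?_
      rintro _ hx ⟨t, rfl⟩
      have h0 : i t = 0 := Submodule.disjoint_def.1 hU _ hx ⟨t, rfl⟩
      rw [hi (h0.trans (map_zero i).symm), map_zero]
    refine (Submodule.eq_bot_iff U).2 fun x hx => ?_
    obtain ⟨y, rfl⟩ := C.mkQ_surjective x
    exact (Submodule.Quotient.mk_eq_zero C).2 (hle hx)
  have : Module.Finite A (J ⧸ C) := finite_of_essential k (LinearMap.range i) hess
  have : IsArtinianRing A := IsArtinianRing.of_finite k A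
  obtain ⟨φ, hφ⟩ := Module.Injective.out i hi i₀
  have hbij : Function.Bijective (C.mkQ ∘ₗ φ) := by
    refine IsArtinian.bijective_of_injective_endomorphism _ (LinearMap.ker_eq_bot.1 (hess _ ?_))
    refine Submodule.disjoint_def.2 ?_
    rintro _ hx ⟨t, rfl⟩
    exact (congrArg C.mkQ (hφ t)).symm.trans (LinearMap.mem_ker.1 hx)
  let ψ := LinearEquiv.ofBijective _ hbij
  refine ⟨ModuleCat.of A (J ⧸ C), i, inferInstance, ⟨fun X Y _ _ _ _ f hf g => ?_⟩, hi⟩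
  obtain ⟨h, hh⟩ := Module.Injective.out f hf (φ ∘ₗ g)
  refine ⟨ψ.symm.toLinearMap ∘ₗ C.mkQ ∘ₗ h, fun x => ?_⟩
  have : ψ (g x) = C.mkQ (h (f x)) := by rw [hh]; rfl
  simp [← this]

section Lemmas

variable (A : Type u) [Ring A]

lemma memAdd_of_retract {S : Set (ModuleCat.{u} A)} {ι : Type} [Fintype ι] {X : ModuleCat.{u} A}
    (M : ι → ModuleCat.{u} A) (hM : ∀ i, M i ∈ S) (s : ∀ i, X →ₗ[A] M i) (t : ∀ i, M i →ₗ[A] X)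
    (h : ∑ i, t i ∘ₗ s i = LinearMap.id) : memAdd A S X := by
  classical
  let e := Fintype.equivFin ι
  let N : Fin (Fintype.card ι) → ModuleCat.{u} A := fun j => M (e.symm j)
  let a : X →ₗ[A] (∀ j, N j) := LinearMap.pi fun j => s (e.symm j)
  let b : (∀ j, N j) →ₗ[A] X := ∑ j, t (e.symm j) ∘ₗ LinearMap.proj j
  have hba : ∀ x, b (a x) = x := fun x => by
    have h1 : b (a x) = ∑ j, t (e.symm j) (s (e.symm j) x) := by simp [a, b]
    rw [h1, e.symm.sum_comp fun i => t i (s i x)]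
    simpa using LinearMap.congr_fun h x
  refine ⟨_, N, ModuleCat.of A (LinearMap.ker b), fun j => hM _, ⟨?_⟩⟩
  refine LinearEquiv.ofBijective (LinearMap.coprod a (LinearMap.ker b).subtype) ⟨?_, ?_⟩
  · refine (injective_iff_map_eq_zero _).2 ?_
    rintro ⟨x, z, hz⟩ hxz
    have hxz' : a x + z = 0 := hxz
    have hx : x = 0 := by
      have := congrArg b hxz'
      rwa [map_add, hba, LinearMap.mem_ker.1 hz, add_zero, map_zero] at this
    subst hx
    have hz0 : z = 0 := by simpa using hxz'
    subst hz0
    rfl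
  · intro z
    refine ⟨(b z, ⟨z - a (b z), ?_⟩), ?_⟩
    · rw [LinearMap.mem_ker, map_sub, hba, sub_self]
    · exact add_sub_cancel (a (b z)) z

lemma exists_retract_of_memAdd {S : Set (ModuleCat.{u} A)} {X : ModuleCat.{u} A}
    (h : memAdd A S X) :
    ∃ (n : ℕ) (M : Fin n → ModuleCat.{u} A) (s : ∀ i, X →ₗ[A] M i) (t : ∀ i, M i →ₗ[A] X),
      (∀ i, M i ∈ S) ∧ ∑ i, t i ∘ₗ s i = LinearMap.id := by
  obtain ⟨n, M, Y, hM, ⟨e⟩⟩ := h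
  refine ⟨n, M, fun i => LinearMap.proj i ∘ₗ e.toLinearMap ∘ₗ LinearMap.inl A X Y,
    fun i => LinearMap.fst A X Y ∘ₗ e.symm.toLinearMap ∘ₗ LinearMap.single A (fun i => M i) i,
    hM, ?_⟩
  ext x
  have h1 : ∑ i, LinearMap.single A (fun i => M i) i (e (x, 0) i) = e (x, 0) :=
    Finset.univ_sum_single _
  have h2 := congrArg (fun z => (e.symm z).1) h1
  simpa [map_sum, Prod.fst_sum] using h2

lemma memAdd_trans {S : Set (ModuleCat.{u} A)} {ι : Type} [Fintype ι] {X : ModuleCat.{u} A}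
    (M : ι → ModuleCat.{u} A) (hM : ∀ i, memAdd A S (M i)) (s : ∀ i, X →ₗ[A] M i)
    (t : ∀ i, M i →ₗ[A] X) (h : ∑ i, t i ∘ₗ s i = LinearMap.id) : memAdd A S X := by
  choose n N s' t' hN h' using fun i => exists_retract_of_memAdd A (hM i)
  refine memAdd_of_retract A (ι := Σ i, Fin (n i)) (fun p => N p.1 p.2) (fun p => hN p.1 p.2)
    (fun p => s' p.1 p.2 ∘ₗ s p.1) (fun p => t p.1 ∘ₗ t' p.1 p.2) ?_
  rw [← h, Fintype.sum_sigma]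
  refine Finset.sum_congr rfl fun i _ => ?_
  ext x
  have := congrArg (t i) (LinearMap.congr_fun (h' i) (s i x))
  simpa using this

lemma memAdd_of_section {S : Set (ModuleCat.{u} A)} {X M : ModuleCat.{u} A} (hM : memAdd A S M)
    (s : X →ₗ[A] M) (t : M →ₗ[A] X) (h : ∀ x, t (s x) = x) : memAdd A S X :=
  memAdd_trans A (ι := Unit) (fun _ => M) (fun _ => hM) (fun _ => s) (fun _ => t)
    (by ext x; simp [h])

lemma subset_memAdd {S : Set (ModuleCat.{u} A)} {X : ModuleCat.{u} A} (hX : X ∈ S) :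
    memAdd A S X :=
  memAdd_of_retract A (ι := Unit) (fun _ => X) (fun _ => hX) (fun _ => LinearMap.id)
    (fun _ => LinearMap.id) (by ext; simp)

lemma memAdd_pi {S : Set (ModuleCat.{u} A)} {X : ModuleCat.{u} A} (hX : memAdd A S X) (m : ℕ) :
    memAdd A S (ModuleCat.of A (Fin m → X)) := by
  refine memAdd_trans A (ι := Fin m) (fun _ => X) (fun _ => hX) (fun i => LinearMap.proj i)
    (fun i => LinearMap.single A (fun _ => X) i) ?_
  refine LinearMap.ext fun x => ?_
  have : ∑ i, LinearMap.single A (fun _ : Fin m => (X : Type u)) i (x i) = x :=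
    Finset.univ_sum_single x
  simpa using this

lemma memAdd_finite {S : Set (ModuleCat.{u} A)} {X : ModuleCat.{u} A}
    (hS : ∀ M ∈ S, Module.Finite A M) (hX : memAdd A S X) : Module.Finite A X := by
  obtain ⟨n, M, Y, hM, ⟨e⟩⟩ := hX
  have : ∀ i, Module.Finite A (M i) := fun i => hS _ (hM i)
  exact Module.Finite.of_surjective (LinearMap.fst A X Y ∘ₗ e.symm.toLinearMap)
    (Prod.fst_surjective.comp e.symm.surjective)

lemma memAdd_of_subsingleton (S : Set (ModuleCat.{u} A)) (X : ModuleCat.{u} A) [Subsingleton X] :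
    memAdd A S X :=
  memAdd_of_retract A (ι := Empty) (fun i => i.elim) (fun i => i.elim) (fun i => i.elim)
    (fun i => i.elim) (LinearMap.ext fun _ => Subsingleton.elim _ _)

lemma bracket_of_subsingleton (T : ModuleCat.{u} A) (n : ℕ) (X : ModuleCat.{u} A)
    [Subsingleton X] : X ∈ bracket A T (n + 1) := by
  cases n with
  | zero => exact memAdd_of_subsingleton A _ X
  | succ n => exact memAdd_of_subsingleton A _ X

lemma finite_of_mem_addOf {T X : ModuleCat.{u} A} [Module.Finite A T] (hX : X ∈ addOf A T) :
    Module.Finite A X :=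
  memAdd_finite A (by rintro _ rfl; infer_instance) hX

lemma addOf_subset_bracket (T : ModuleCat.{u} A) [Module.Finite A T] (n : ℕ) :
    addOf A T ⊆ bracket A T (n + 1) := by
  intro X hX
  cases n with
  | zero => exact hX
  | succ n =>
    refine subset_memAdd A ⟨finite_of_mem_addOf A hX, X, ModuleCat.of A PUnit, LinearMap.id, 0, hX,
      bracket_of_subsingleton A T n _, fun _ _ h => h, fun _ => ⟨0, Subsingleton.elim _ _⟩, ?_⟩
    simp

/-- The generating class of which `[T]ₙ` is the closure under finite sums and summands. -/
def bracketGen (T : ModuleCat.{u} A) : ℕ → Set (ModuleCat.{u} A)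
  | 0 => {T}
  | (n+1) => {W | Module.Finite A W ∧
    ∃ (T₁ T₂ : ModuleCat.{u} A) (f : T₁ →ₗ[A] W) (g : W →ₗ[A] T₂),
      T₁ ∈ addOf A T ∧ T₂ ∈ bracket A T (n + 1) ∧ IsSES A f g}

lemma mem_bracket_succ (T : ModuleCat.{u} A) (n : ℕ) (X : ModuleCat.{u} A) :
    X ∈ bracket A T (n + 1) ↔ memAdd A (bracketGen A T n) X := by
  cases n <;> rfl

attribute [instance] StObj.fin

variable {A}

/-- The class of a homomorphism in the stable category. -/
def st {X Y : StObj A} : (X.M →ₗ[A] Y.M) →+ (X ⟶ Y) where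
  toFun f := QuotientAddGroup.mk (ModuleCat.ofHom f)
  map_zero' := rfl
  map_add' _ _ := rfl

lemma st_surjective {X Y : StObj A} (f : X ⟶ Y) : ∃ g : X.M →ₗ[A] Y.M, st g = f := by
  obtain ⟨g, rfl⟩ := QuotientAddGroup.mk_surjective f
  exact ⟨g.hom, rfl⟩

lemma st_id (X : StObj A) : st (LinearMap.id : X.M →ₗ[A] X.M) = 𝟙 X := rfl

lemma st_comp {X Y Z : StObj A} (f : X.M →ₗ[A] Y.M) (g : Y.M →ₗ[A] Z.M) :
    st f ≫ st g = st (g ∘ₗ f) := rfl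

lemma st_eq_zero_iff {X Y : StObj A} (f : X.M →ₗ[A] Y.M) :
    st f = 0 ↔ ∃ (P : ModuleCat.{u} A) (_ : Module.Projective A P) (g : X.M →ₗ[A] P)
      (h : P →ₗ[A] Y.M), f = h ∘ₗ g := by
  refine (QuotientAddGroup.eq_zero_iff (N := projHoms A X.M Y.M) (ModuleCat.ofHom f)).trans ?_
  constructor
  · rintro ⟨P, hP, g, h, hf⟩
    exact ⟨P, (IsProjective.iff_projective P).2 hP, g.hom, h.hom,
      congrArg ModuleCat.Hom.hom hf⟩
  · rintro ⟨P, hP, g, h, rfl⟩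
    exact ⟨P, (IsProjective.iff_projective P).1 hP, ModuleCat.ofHom g, ModuleCat.ofHom h, rfl⟩

lemma st_eq_zero_of_projective {X Y : StObj A} {P : Type u} [AddCommGroup P] [Module A P]
    [Module.Projective A P] (g : X.M →ₗ[A] P) (h : P →ₗ[A] Y.M) : st (h ∘ₗ g) = 0 :=
  (st_eq_zero_iff _).2 ⟨ModuleCat.of A P, inferInstance, g, h, rfl⟩

instance : Preadditive (StObj A) where
  add_comp X Y Z f f' g := by
    obtain ⟨f, rfl⟩ := st_surjective f
    obtain ⟨f', rfl⟩ := st_surjective f'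
    obtain ⟨g, rfl⟩ := st_surjective g
    rw [← map_add, st_comp, st_comp, st_comp, ← map_add, LinearMap.comp_add]
  comp_add X Y Z f g g' := by
    obtain ⟨f, rfl⟩ := st_surjective f
    obtain ⟨g, rfl⟩ := st_surjective g
    obtain ⟨g', rfl⟩ := st_surjective g'
    rw [← map_add, st_comp, st_comp, st_comp, ← map_add, LinearMap.add_comp]

lemma memAdd_of_stable_retract {S : Set (ModuleCat.{u} A)} {ι : Type} [Fintype ι] {X : StObj A}
    (Z : ι → StObj A) (hZ : ∀ i, memAdd A S (Z i).M) (hA : memAdd A S (ModuleCat.of A A))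
    (σ : ∀ i, X ⟶ Z i) (τ : ∀ i, Z i ⟶ X) (h : ∑ i, σ i ≫ τ i = 𝟙 X) : memAdd A S X.M := by
  choose s hs using fun i => st_surjective (σ i)
  choose t ht using fun i => st_surjective (τ i)
  have h0 : st (LinearMap.id - ∑ i, t i ∘ₗ s i : X.M →ₗ[A] X.M) = 0 := by
    rw [map_sub, map_sum, st_id, ← h, sub_eq_zero]
    simp only [← hs, ← ht, st_comp]
  obtain ⟨P, hP, g, f, hfg⟩ := (st_eq_zero_iff _).1 h0
  obtain ⟨N, q, hq⟩ := Module.Finite.exists_fin' A X.M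
  obtain ⟨f', rfl⟩ := Module.projective_lifting_property q f hq
  refine memAdd_trans A (ι := ι ⊕ Unit) (Sum.elim (fun i => (Z i).M)
    fun _ => ModuleCat.of A (Fin N → ModuleCat.of A A)) ?_
    (fun i => match i with
      | .inl i => s i
      | .inr _ => f' ∘ₗ g)
    (fun i => match i with
      | .inl i => t i
      | .inr _ => q) ?_
  · rintro (i | _)
    · exact hZ i
    · exact memAdd_pi A hA N
  · rw [Fintype.sum_sum_type]
    simp only [Finset.univ_unique, Finset.sum_singleton]
    exact (add_comm _ _).trans (sub_eq_iff_eq_add.1 hfg).symm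

/-- The pullback of `m` copies of `π` along a family of maps `ξ i : X → S`. -/
def pull {I S X : Type u} [AddCommGroup I] [AddCommGroup S] [AddCommGroup X] [Module A I]
    [Module A S] [Module A X] (π : I →ₗ[A] S) {m : ℕ} (ξ : Fin m → X →ₗ[A] S) :
    Submodule A ((Fin m → I) × X) where
  carrier := {p | ∀ i, π (p.1 i) = ξ i p.2}
  zero_mem' i := by simp
  add_mem' {p q} hp hq i := by simp [hp i, hq i]
  smul_mem' c p hp i := by simp [hp i]

section Pullback

variable [IsNoetherianRing A] {I S X : StObj A} (π : I.M →ₗ[A] S.M) {m : ℕ}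
  (ξ : Fin m → X.M →ₗ[A] S.M)

/-- The pullback of `m` copies of `π` along `ξ`, as a finitely generated module. -/
def pullObj : StObj A := ⟨ModuleCat.of A (pull π ξ), inferInstanceAs (Module.Finite A (pull π ξ))⟩

/-- The `i`-th projection of the pullback to `I`. -/
def pullFst (i : Fin m) : (pullObj π ξ).M →ₗ[A] I.M :=
  LinearMap.proj i ∘ₗ LinearMap.fst A (Fin m → I.M) X.M ∘ₗ (pull π ξ).subtype

/-- The projection of the pullback to `X`. -/
def pullSnd : (pullObj π ξ).M →ₗ[A] X.M :=
  LinearMap.snd A (Fin m → I.M) X.M ∘ₗ (pull π ξ).subtype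

/-- The map into the pullback given by a compatible family. -/
def pullLift {V : Type u} [AddCommGroup V] [Module A V] (v : Fin m → V →ₗ[A] I.M)
    (y : V →ₗ[A] X.M) (h : ∀ i, π ∘ₗ v i = ξ i ∘ₗ y) : V →ₗ[A] (pullObj π ξ).M :=
  LinearMap.codRestrict (pull π ξ) (LinearMap.prod (LinearMap.pi v) y)
    fun x i => LinearMap.congr_fun (h i) x

variable {π ξ}

lemma pull_hom_ext {V : Type u} [AddCommGroup V] [Module A V] {f g : V →ₗ[A] (pullObj π ξ).M}
    (h₁ : ∀ i, pullFst π ξ i ∘ₗ f = pullFst π ξ i ∘ₗ g)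
    (h₂ : pullSnd π ξ ∘ₗ f = pullSnd π ξ ∘ₗ g) : f = g := by
  ext x
  refine Subtype.ext (Prod.ext (funext fun i => ?_) ?_)
  · exact LinearMap.congr_fun (h₁ i) x
  · exact LinearMap.congr_fun h₂ x

lemma pull_condition (i : Fin m) : π ∘ₗ pullFst π ξ i = ξ i ∘ₗ pullSnd π ξ :=
  LinearMap.ext fun x => x.2 i

lemma pullFst_lift {V : Type u} [AddCommGroup V] [Module A V] (v : Fin m → V →ₗ[A] I.M)
    (y : V →ₗ[A] X.M) (h : ∀ i, π ∘ₗ v i = ξ i ∘ₗ y) (i : Fin m) :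
    pullFst π ξ i ∘ₗ pullLift π ξ v y h = v i := rfl

lemma pullSnd_lift {V : Type u} [AddCommGroup V] [Module A V] (v : Fin m → V →ₗ[A] I.M)
    (y : V →ₗ[A] X.M) (h : ∀ i, π ∘ₗ v i = ξ i ∘ₗ y) :
    pullSnd π ξ ∘ₗ pullLift π ξ v y h = y := rfl

/-- The pullback is a weak pullback in the stable category. -/
lemma exists_stable_lift (hπ : Function.Surjective π) {V : StObj A} (v : Fin m → (V ⟶ I))
    (y : V ⟶ X) (h : ∀ i, v i ≫ st π = y ≫ st (ξ i)) :
    ∃ w : V ⟶ pullObj π ξ,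
      (∀ i, w ≫ st (pullFst π ξ i) = v i) ∧ w ≫ st (pullSnd π ξ) = y := by
  choose v' hv using fun i => st_surjective (v i)
  obtain ⟨y, rfl⟩ := st_surjective y
  have h0 : ∀ i, st (π ∘ₗ v' i - ξ i ∘ₗ y) = 0 := fun i => by
    rw [map_sub, ← st_comp, ← st_comp, hv, h, sub_self]
  choose P hP a d hd using fun i => (st_eq_zero_iff _).1 (h0 i)
  choose δ hδ using fun i => Module.projective_lifting_property π (d i) hπ
  have hc : ∀ i, π ∘ₗ (v' i - δ i ∘ₗ a i) = ξ i ∘ₗ y := fun i => by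
    rw [LinearMap.comp_sub, ← LinearMap.comp_assoc, hδ, ← hd, sub_sub_cancel]
  refine ⟨st (pullLift π ξ _ y hc), fun i => ?_, ?_⟩
  · rw [st_comp, pullFst_lift, map_sub, st_eq_zero_of_projective, sub_zero, hv]
  · rw [st_comp, pullSnd_lift]

/-- A stable map into the pullback with vanishing components factors through copies of a syzygy. -/
lemma exists_syzygy_factorization (hπ : Function.Surjective π) {N : ℕ}
    {q : (Fin N → A) →ₗ[A] S.M} (hq : Function.Surjective q) {K : StObj A}
    {j : K.M →ₗ[A] (Fin N → A)} (hj : Function.Injective j)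
    (hjq : LinearMap.range j = LinearMap.ker q) {V : StObj A}
    (θ : V ⟶ pullObj π ξ) (h₁ : ∀ i, θ ≫ st (pullFst π ξ i) = 0)
    (h₂ : θ ≫ st (pullSnd π ξ) = 0) :
    ∃ (s : Fin m → (V ⟶ K)) (t : Fin m → (K ⟶ pullObj π ξ)), θ = ∑ i, s i ≫ t i := by
  classical
  obtain ⟨θ, rfl⟩ := st_surjective θ
  choose R hR a b hab using fun i => (st_eq_zero_iff _).1 (h₁ i)
  obtain ⟨R₀, hR₀, a₀, b₀, hab₀⟩ := (st_eq_zero_iff _).1 h₂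
  obtain ⟨l, hl⟩ := Module.projective_lifting_property π q hπ
  obtain ⟨R', hR', α, β, β₀, hα, hα₀⟩ : ∃ (R' : ModuleCat.{u} A) (_ : Module.Projective A R')
      (α : V.M →ₗ[A] R') (β : Fin m → R' →ₗ[A] I.M) (β₀ : R' →ₗ[A] X.M),
      (∀ i, β i ∘ₗ α = pullFst π ξ i ∘ₗ θ) ∧ β₀ ∘ₗ α = pullSnd π ξ ∘ₗ θ := by
    have : Module.Projective A (∀ i, R i) :=
      Module.Projective.of_equiv (DFinsupp.linearEquivFunOnFintype (R := A) (M := fun i => R i))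
    exact ⟨ModuleCat.of A ((∀ i, R i) × R₀), inferInstance,
      LinearMap.prod (LinearMap.pi a) a₀,
      fun i => b i ∘ₗ LinearMap.proj i ∘ₗ LinearMap.fst A _ _, b₀ ∘ₗ LinearMap.snd A _ _,
      fun i => (hab i).symm, hab₀.symm⟩
  choose d hd using fun i =>
    Module.projective_lifting_property q (π ∘ₗ β i - ξ i ∘ₗ β₀) hq
  have hdα : ∀ i x, ∃ y, j y = d i (α x) := fun i x => by
    have : d i (α x) ∈ LinearMap.range j := by
      rw [hjq, LinearMap.mem_ker]
      have e1 := LinearMap.congr_fun (hd i) (α x)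
      have e2 := LinearMap.congr_fun (hα i) x
      have e3 := LinearMap.congr_fun hα₀ x
      have e4 := LinearMap.congr_fun (pull_condition (π := π) (ξ := ξ) i) (θ x)
      simp only [LinearMap.comp_apply, LinearMap.sub_apply] at e1 e2 e3 e4
      rw [e1, e2, e3, e4, sub_self]
    exact this
  have hsig : ∀ i, ∃ s : V.M →ₗ[A] K.M, j ∘ₗ s = d i ∘ₗ α := fun i => by
    let jE := LinearEquiv.ofInjective j hj
    refine ⟨jE.symm.toLinearMap ∘ₗ LinearMap.codRestrict (LinearMap.range j) (d i ∘ₗ α)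
      (hdα i), LinearMap.ext fun x => ?_⟩
    exact congrArg Subtype.val (jE.apply_symm_apply ⟨d i (α x), hdα i x⟩)
  choose s hs using hsig
  have hqj : q ∘ₗ j = 0 := LinearMap.range_le_ker_iff.1 hjq.le
  have hlj : π ∘ₗ l ∘ₗ j = 0 := by rw [← LinearMap.comp_assoc, hl, hqj]
  let t : Fin m → K.M →ₗ[A] (pullObj π ξ).M := fun i =>
    pullLift π ξ (fun i' => if i' = i then l ∘ₗ j else 0) 0 fun i' => by
      split_ifs
      · rw [hlj, LinearMap.comp_zero]
      · simp
  have hγ : ∀ i, π ∘ₗ (β i - l ∘ₗ d i) = ξ i ∘ₗ β₀ := fun i => by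
    rw [LinearMap.comp_sub, ← LinearMap.comp_assoc, hl, hd, sub_sub_cancel]
  refine ⟨fun i => st (s i), fun i => st (t i), ?_⟩
  have key : θ = ∑ i, t i ∘ₗ s i + pullLift π ξ _ β₀ hγ ∘ₗ α := by
    refine pull_hom_ext (fun i => LinearMap.ext fun x => ?_) (LinearMap.ext fun x => ?_)
    · have e1 : ∀ i', pullFst π ξ i (t i' (s i' x)) = if i = i' then l (d i (α x)) else 0 := by
        intro i'
        have : pullFst π ξ i ∘ₗ t i' = if i = i' then l ∘ₗ j else 0 := rfl
        rw [← LinearMap.comp_apply, this]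
        split_ifs with h
        · subst h
          exact congrArg l (LinearMap.congr_fun (hs i) x)
        · rfl
      have e2 : pullFst π ξ i (pullLift π ξ _ β₀ hγ (α x)) = β i (α x) - l (d i (α x)) := rfl
      have e3 := LinearMap.congr_fun (hα i) x
      simp only [LinearMap.comp_apply] at e3
      simp [e1, e2, e3]
    · have e1 : ∀ i', pullSnd π ξ (t i' (s i' x)) = 0 := fun _ => rfl
      have e2 : pullSnd π ξ (pullLift π ξ _ β₀ hγ (α x)) = β₀ (α x) := rfl
      have e3 := LinearMap.congr_fun hα₀ x
      simp only [LinearMap.comp_apply] at e3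
      simp [e1, e2, e3]
  rw [key, map_add, st_eq_zero_of_projective, add_zero, map_sum]
  rfl

end Pullback

end Lemmas

lemma exists_comp_eq_of_ker_le {A M N P : Type*} [Ring A] [AddCommGroup M] [AddCommGroup N]
    [AddCommGroup P] [Module A M] [Module A N] [Module A P] {φ : M →ₗ[A] N}
    (hφ : Function.Surjective φ) {ψ : M →ₗ[A] P} (h : LinearMap.ker φ ≤ LinearMap.ker ψ) :
    ∃ χ : N →ₗ[A] P, χ ∘ₗ φ = ψ := by
  refine ⟨(LinearMap.ker φ).liftQ ψ h ∘ₗ (φ.quotKerEquivOfSurjective hφ).symm.toLinearMap,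
    LinearMap.ext fun x => ?_⟩
  have : (φ.quotKerEquivOfSurjective hφ).symm (φ x) = (LinearMap.ker φ).mkQ x := by
    rw [LinearEquiv.symm_apply_eq]
    rfl
  simp [this]

section Equivalence

variable {A B : Type u} [Ring A] [Ring B] [IsNoetherianRing A] [IsNoetherianRing B]

/-- An extension of `X` by a summand of `Tᵐ` is a retract of the corresponding pullback of a
sequence `0 → T → I → S → 0` with `I` injective. -/
lemma exists_retract_pull {T : ModuleCat.{u} A} {I S : StObj A} [Module.Injective A I.M]
    {i : T →ₗ[A] I.M} {π : I.M →ₗ[A] S.M} (hi : Function.Injective i)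
    (hiπ : LinearMap.range i = LinearMap.ker π) {T₁ : ModuleCat.{u} A} (hT₁ : T₁ ∈ addOf A T)
    {W X : StObj A} {f : T₁ →ₗ[A] W.M} {g : W.M →ₗ[A] X.M} (hfg : IsSES A f g) :
    ∃ (m : ℕ) (ξ : Fin m → X.M →ₗ[A] S.M) (σ : W.M →ₗ[A] (pullObj π ξ).M)
      (ρ : (pullObj π ξ).M →ₗ[A] W.M), ρ ∘ₗ σ = LinearMap.id := by
  obtain ⟨hf, hg, hfg⟩ := hfg
  obtain ⟨m, M, s, t, hM, hst⟩ := exists_retract_of_memAdd A hT₁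
  obtain rfl : M = fun _ => T := funext hM
  choose u hu using fun l => Module.Injective.out f hf (i ∘ₗ s l)
  have hgf : ∀ x, g (f x) = 0 := fun x => LinearMap.mem_ker.1 (hfg ▸ ⟨x, rfl⟩)
  have hπi : ∀ x, π (i x) = 0 := fun x => LinearMap.mem_ker.1 (hiπ ▸ ⟨x, rfl⟩)
  have hξ : ∀ l, ∃ ξ : X.M →ₗ[A] S.M, π ∘ₗ u l = ξ ∘ₗ g := fun l => by
    refine (exists_comp_eq_of_ker_le hg (ψ := π ∘ₗ u l) ?_).imp fun _ h => h.symm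
    rw [← hfg]
    rintro _ ⟨x, rfl⟩
    simp [hu, hπi]
  choose ξ hξ using hξ
  let σ : W.M →ₗ[A] (pullObj π ξ).M := pullLift π ξ u g hξ
  let κ : (Fin m → T) →ₗ[A] (pullObj π ξ).M :=
    pullLift π ξ (fun l => i ∘ₗ LinearMap.proj l) 0 fun l => LinearMap.ext fun x => by simp [hπi]
  let φ : (W.M × (Fin m → T)) →ₗ[A] (pullObj π ξ).M := LinearMap.coprod σ κ
  let ψ : (W.M × (Fin m → T)) →ₗ[A] W.M :=
    LinearMap.coprod LinearMap.id (f ∘ₗ ∑ l, t l ∘ₗ LinearMap.proj l)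
  have hφ : Function.Surjective φ := by
    intro z
    obtain ⟨w, hw⟩ := hg (pullSnd π ξ z)
    have hz : ∀ l, ∃ y, i y = pullFst π ξ l z - u l w := fun l => by
      have : pullFst π ξ l z - u l w ∈ LinearMap.range i := by
        rw [hiπ, LinearMap.mem_ker, map_sub]
        have e1 : π (pullFst π ξ l z) = ξ l (pullSnd π ξ z) :=
          LinearMap.congr_fun (pull_condition l) z
        have e2 : π (u l w) = ξ l (g w) := LinearMap.congr_fun (hξ l) w
        rw [e1, e2, hw, sub_self]
      exact this
    choose y hy using hz
    refine ⟨(w, y), Subtype.ext (Prod.ext (funext fun l => ?_) ?_)⟩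
    · change u l w + i (y l) = pullFst π ξ l z
      rw [hy, add_sub_cancel]
    · change g w + 0 = pullSnd π ξ z
      rw [hw, add_zero]
  have hker : LinearMap.ker φ ≤ LinearMap.ker ψ := by
    rintro ⟨w, y⟩ hwy
    have h₁ : ∀ l, u l w + i (y l) = 0 := fun l =>
      LinearMap.congr_arg (f := pullFst π ξ l) (LinearMap.mem_ker.1 hwy)
    have h₂ : g w + 0 = 0 := LinearMap.congr_arg (f := pullSnd π ξ) (LinearMap.mem_ker.1 hwy)
    obtain ⟨x, rfl⟩ : w ∈ LinearMap.range f := by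
      rw [hfg, LinearMap.mem_ker, ← h₂, add_zero]
    have hy : ∀ l, y l = - s l x := fun l => hi <| by
      have := h₁ l
      rw [hu] at this
      rw [map_neg]
      exact (neg_eq_of_add_eq_zero_right this).symm
    have hx := LinearMap.congr_fun hst x
    simp only [LinearMap.sum_apply, LinearMap.comp_apply, LinearMap.id_apply] at hx
    simp [ψ, hy, hx]
  obtain ⟨ρ, hρ⟩ := exists_comp_eq_of_ker_le hφ hker
  refine ⟨m, ξ, σ, ρ, LinearMap.ext fun w => ?_⟩
  have := LinearMap.congr_fun hρ (w, 0)
  simpa [φ, ψ] using this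

/-- Up to copies of a syzygy, an equivalence of stable categories commutes with pullbacks. -/
lemma exists_stable_decomposition (e : StObj A ≌ StObj B) [e.functor.Additive]
    {I S X : StObj A} {π : I.M →ₗ[A] S.M} (hπ : Function.Surjective π) {N : ℕ}
    {q : (Fin N → A) →ₗ[A] S.M} (hq : Function.Surjective q) {K : StObj A}
    {j : K.M →ₗ[A] (Fin N → A)} (hj : Function.Injective j)
    (hjq : LinearMap.range j = LinearMap.ker q) {m : ℕ} (ξ : Fin m → X.M →ₗ[A] S.M)
    {I' : StObj B} {p : I'.M →ₗ[B] (e.functor.obj S).M} (hp : Function.Surjective p)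
    (a : e.functor.obj I ⟶ I') (b : I' ⟶ e.functor.obj I) (hab : a ≫ b = 𝟙 _)
    (hap : a ≫ st p = e.functor.map (st π)) (hbp : b ≫ e.functor.map (st π) = st p)
    (ξ' : Fin m → (e.functor.obj X).M →ₗ[B] (e.functor.obj S).M)
    (hξ : ∀ i, st (ξ' i) = e.functor.map (st (ξ i))) :
    ∃ (v : e.functor.obj (pullObj π ξ) ⟶ pullObj p ξ')
      (r : pullObj p ξ' ⟶ e.functor.obj (pullObj π ξ))
      (s : Fin m → (e.functor.obj (pullObj π ξ) ⟶ e.functor.obj K))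
      (t : Fin m → (e.functor.obj K ⟶ e.functor.obj (pullObj π ξ))),
      v ≫ r + ∑ i, s i ≫ t i = 𝟙 _ := by
  have hcond : ∀ i, st (pullFst π ξ i) ≫ st π = st (pullSnd π ξ) ≫ st (ξ i) := fun i => by
    rw [st_comp, st_comp, pull_condition]
  have hcond' : ∀ i, st (pullFst p ξ' i) ≫ st p = st (pullSnd p ξ') ≫ st (ξ' i) := fun i => by
    rw [st_comp, st_comp, pull_condition]
  obtain ⟨v, hv₁, hv₂⟩ := exists_stable_lift (ξ := ξ') hp
    (fun i => e.functor.map (st (pullFst π ξ i)) ≫ a) (e.functor.map (st (pullSnd π ξ)))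
    (fun i => by rw [Category.assoc, hap, hξ, ← Functor.map_comp, ← Functor.map_comp, hcond])
  let U := e.functor.objPreimage (pullObj p ξ')
  let ε : e.functor.obj U ≅ pullObj p ξ' := e.functor.objObjPreimageIso _
  obtain ⟨w, hw₁, hw₂⟩ := exists_stable_lift (ξ := ξ) hπ
    (fun i => e.functor.preimage (ε.hom ≫ st (pullFst p ξ' i) ≫ b))
    (e.functor.preimage (ε.hom ≫ st (pullSnd p ξ')))
    (fun i => e.functor.map_injective (by
      simp only [Functor.map_comp, Functor.map_preimage, Category.assoc, hbp, hcond', hξ]))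
  let r : pullObj p ξ' ⟶ e.functor.obj (pullObj π ξ) := ε.inv ≫ e.functor.map w
  have hr₁ : ∀ i, r ≫ e.functor.map (st (pullFst π ξ i)) = st (pullFst p ξ' i) ≫ b := fun i => by
    rw [Category.assoc, ← Functor.map_comp, hw₁, Functor.map_preimage, Iso.inv_hom_id_assoc]
  have hr₂ : r ≫ e.functor.map (st (pullSnd π ξ)) = st (pullSnd p ξ') := by
    rw [Category.assoc, ← Functor.map_comp, hw₂, Functor.map_preimage, Iso.inv_hom_id_assoc]
  obtain ⟨s, t, hst⟩ := exists_syzygy_factorization hπ hq hj hjq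
    (𝟙 (pullObj π ξ) - e.functor.preimage (v ≫ r))
    (fun i => e.functor.map_injective (by
      rw [Functor.map_comp, Functor.map_sub, Functor.map_preimage, CategoryTheory.Functor.map_id,
        Preadditive.sub_comp, Category.assoc, hr₁, ← Category.assoc v, hv₁, Category.assoc, hab,
        Category.id_comp, Category.comp_id, sub_self, Functor.map_zero]))
    (e.functor.map_injective (by
      rw [Functor.map_comp, Functor.map_sub, Functor.map_preimage, CategoryTheory.Functor.map_id,
        Preadditive.sub_comp, Category.assoc, hr₂, hv₂, Category.id_comp, sub_self,
        Functor.map_zero]))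
  refine ⟨v, r, fun i => e.functor.map (s i), fun i => e.functor.map (t i), ?_⟩
  have := congrArg e.functor.map hst
  rw [Functor.map_sub, Functor.map_preimage, CategoryTheory.Functor.map_id, Functor.map_sum] at this
  simp only [Functor.map_comp] at this
  rw [← this, add_sub_cancel]

lemma pull_mem_bracketGen {I S X : StObj A} {π : I.M →ₗ[A] S.M} (hπ : Function.Surjective π)
    {m : ℕ} (ξ : Fin m → X.M →ₗ[A] S.M) {T : ModuleCat.{u} A}
    (hT : ModuleCat.of A (LinearMap.ker π) ∈ addOf A T) {n : ℕ}
    (hX : X.M ∈ bracket A T (n + 1)) : (pullObj π ξ).M ∈ bracketGen A T (n + 1) := by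
  let κ : (Fin m → LinearMap.ker π) →ₗ[A] (pullObj π ξ).M :=
    pullLift π ξ (fun i => (LinearMap.ker π).subtype ∘ₗ LinearMap.proj i) 0
      fun i => LinearMap.ext fun x => by simp
  refine ⟨(pullObj π ξ).fin, ModuleCat.of A (Fin m → ModuleCat.of A (LinearMap.ker π)), X.M, κ,
    pullSnd π ξ, memAdd_pi A hT m, hX, ?_, ?_, le_antisymm ?_ ?_⟩
  · intro x y hxy
    refine funext fun i => Subtype.ext ?_
    exact LinearMap.congr_arg (f := pullFst π ξ i) hxy
  · intro x
    choose y hy using fun i => hπ (ξ i x)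
    exact ⟨⟨(y, x), hy⟩, rfl⟩
  · rintro _ ⟨x, rfl⟩
    rfl
  · intro z hz
    have hz' : pullSnd π ξ z = 0 := hz
    have hmem : ∀ i, π (pullFst π ξ i z) = 0 := fun i => by
      have := LinearMap.congr_fun (pull_condition (π := π) (ξ := ξ) i) z
      simp only [LinearMap.comp_apply, hz', map_zero] at this
      exact this
    exact ⟨fun i => ⟨pullFst π ξ i z, hmem i⟩, Subtype.ext (Prod.ext rfl hz'.symm)⟩

/-- Stable equivalences preserve iterated extensions of add-closures, up to changing the
generator. -/
lemma exists_bracket_transfer (k : Type u) [CommRing k] [IsArtinianRing k] [Algebra k A]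
    [Module.Finite k A] (e : StObj A ≌ StObj B) [e.functor.Additive] (T : ModuleCat.{u} A)
    [Module.Finite A T] :
    ∃ T' : ModuleCat.{u} B, Module.Finite B T' ∧ ModuleCat.of B B ∈ addOf B T' ∧
      ∀ (n : ℕ) (X : StObj A), X.M ∈ bracket A T (n + 1) →
        (e.functor.obj X).M ∈ bracket B T' (n + 1) := by
  let F := e.functor
  obtain ⟨I₀, i, hI₀, hinj, hi⟩ := exists_finite_injective k A T
  let I : StObj A := ⟨I₀, hI₀⟩
  let S : StObj A := ⟨ModuleCat.of A (I₀ ⧸ LinearMap.range i), inferInstance⟩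
  have : Module.Injective A I.M := hinj
  let π : I.M →ₗ[A] S.M := (LinearMap.range i).mkQ
  have hπ : Function.Surjective π := Submodule.mkQ_surjective _
  have hiπ : LinearMap.range i = LinearMap.ker π := (Submodule.ker_mkQ _).symm
  obtain ⟨N, q, hq⟩ := Module.Finite.exists_fin' A S.M
  let K : StObj A := ⟨ModuleCat.of A (LinearMap.ker q), inferInstance⟩
  let j : K.M →ₗ[A] (Fin N → A) := (LinearMap.ker q).subtype
  have hj : Function.Injective j := Subtype.val_injective
  have hjq : LinearMap.range j = LinearMap.ker q := Submodule.range_subtype _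
  obtain ⟨N', q', hq'⟩ := Module.Finite.exists_fin' B (F.obj S).M
  let I' : StObj B := ⟨ModuleCat.of B ((F.obj I).M × (Fin N' → B)), inferInstance⟩
  obtain ⟨π', hπ'⟩ := st_surjective (F.map (st π))
  let p : I'.M →ₗ[B] (F.obj S).M := LinearMap.coprod π' q'
  have hp : Function.Surjective p := fun y => by
    obtain ⟨x, rfl⟩ := hq' y
    refine ⟨(0, x), ?_⟩
    change π' 0 + q' x = q' x
    rw [map_zero, zero_add]
  let a : (F.obj I).M →ₗ[B] I'.M := LinearMap.inl B _ _
  let b : I'.M →ₗ[B] (F.obj I).M := LinearMap.fst B _ _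
  have hab : st a ≫ st b = 𝟙 _ := by
    rw [st_comp, ← st_id]
    rfl
  have hap : st a ≫ st p = F.map (st π) := by
    rw [st_comp, ← hπ']
    exact congrArg st (LinearMap.coprod_inl π' q')
  have hbp : st b ≫ F.map (st π) = st p := by
    rw [← hπ', st_comp]
    have hp' : p = π' ∘ₗ b + q' ∘ₗ LinearMap.snd B _ _ := rfl
    have h0 : st (q' ∘ₗ LinearMap.snd B _ _ : I'.M →ₗ[B] (F.obj S).M) = 0 :=
      st_eq_zero_of_projective (X := I') (LinearMap.snd B (F.obj I).M (Fin N' → B)) q'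
    rw [hp', map_add, h0, add_zero]
  let K' : ModuleCat.{u} B := ModuleCat.of B (LinearMap.ker p)
  let T' : ModuleCat.{u} B :=
    ModuleCat.of B (K' × (F.obj K).M × B × (F.obj ⟨T, inferInstance⟩).M)
  have hT'fin : Module.Finite B T' := inferInstanceAs
    (Module.Finite B (LinearMap.ker p × (F.obj K).M × B × (F.obj ⟨T, inferInstance⟩).M))
  have hT' : memAdd B {T'} T' := subset_memAdd B rfl
  have hK' : K' ∈ addOf B T' :=
    memAdd_of_section B hT' (LinearMap.inl B _ _) (LinearMap.fst B _ _) fun _ => rfl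
  have hFK : (F.obj K).M ∈ addOf B T' :=
    memAdd_of_section B hT' (LinearMap.inr B _ _ ∘ₗ LinearMap.inl B _ _)
      (LinearMap.fst B _ _ ∘ₗ LinearMap.snd B _ _) fun _ => rfl
  have hB : ModuleCat.of B B ∈ addOf B T' :=
    memAdd_of_section B hT'
      (LinearMap.inr B _ _ ∘ₗ LinearMap.inr B _ _ ∘ₗ LinearMap.inl B _ _)
      (LinearMap.fst B _ _ ∘ₗ LinearMap.snd B _ _ ∘ₗ LinearMap.snd B _ _) fun _ => rfl
  have hFT : (F.obj ⟨T, inferInstance⟩).M ∈ addOf B T' :=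
    memAdd_of_section B hT'
      (LinearMap.inr B _ _ ∘ₗ LinearMap.inr B _ _ ∘ₗ LinearMap.inr B _ _)
      (LinearMap.snd B _ _ ∘ₗ LinearMap.snd B _ _ ∘ₗ LinearMap.snd B _ _) fun _ => rfl
  have mem_add : ∀ {n : ℕ} {Y : ModuleCat.{u} B}, Y ∈ addOf B T' →
      memAdd B (bracketGen B T' n) Y := fun {n Y} hY =>
    (mem_bracket_succ B T' n Y).1 (addOf_subset_bracket B T' n hY)
  refine ⟨T', hT'fin, hB, fun n => ?_⟩
  have extend : ∀ n : ℕ, (∀ W : StObj A, W.M ∈ bracketGen A T n →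
      memAdd B (bracketGen B T' n) (F.obj W).M) →
      ∀ X : StObj A, X.M ∈ bracket A T (n + 1) → (F.obj X).M ∈ bracket B T' (n + 1) := by
    intro n hn X hX
    rw [mem_bracket_succ] at hX ⊢
    obtain ⟨l, M, s, t, hM, hst⟩ := exists_retract_of_memAdd A hX
    have hfin : ∀ i, Module.Finite A (M i) := fun i => by
      cases n with
      | zero => obtain rfl : M i = T := hM i; infer_instance
      | succ n => exact (hM i).1
    refine memAdd_of_stable_retract (fun i => F.obj ⟨M i, hfin i⟩) (fun i => hn _ (hM i))
      (mem_add hB) (fun i => F.map (st (s i))) (fun i => F.map (st (t i))) ?_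
    have h0 : ∑ i, st (X := X) (Y := ⟨M i, hfin i⟩) (s i) ≫ st (Y := X) (t i) = 𝟙 X :=
      (map_sum st _ _).symm.trans (congrArg st hst)
    simp only [← Functor.map_comp, ← Functor.map_sum]
    rw [h0, CategoryTheory.Functor.map_id]
  induction n with
  | zero =>
    refine extend 0 ?_
    rintro ⟨W, hW⟩ rfl
    exact hFT
  | succ n ih =>
    refine extend (n + 1) ?_
    rintro W ⟨_, T₁, T₂, f, g, hT₁, hT₂, hfg⟩
    let X : StObj A := ⟨T₂, Module.Finite.of_surjective g hfg.2.1⟩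
    obtain ⟨m, ξ, σ, ρ, hρσ⟩ := exists_retract_pull (I := I) (S := S) (π := π) (W := W)
      (X := X) hi hiπ hT₁ hfg
    choose ξ' hξ' using fun l => st_surjective (F.map (st (ξ l)))
    obtain ⟨v, r, s, t, h⟩ := exists_stable_decomposition e hπ hq hj hjq ξ hp (st a) (st b)
      hab hap hbp ξ' hξ'
    have hpull : memAdd B (bracketGen B T' (n + 1)) (F.obj (pullObj π ξ)).M := by
      refine memAdd_of_stable_retract (ι := Option (Fin m))
        (fun o => o.elim (pullObj p ξ') fun _ => F.obj K) ?_ (mem_add hB)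
        (fun o => match o with
          | none => v
          | some l => s l)
        (fun o => match o with
          | none => r
          | some l => t l) ?_
      · rintro (_ | l)
        · exact subset_memAdd B (pull_mem_bracketGen hp ξ' hK' (ih X hT₂))
        · exact mem_add hFK
      · rw [Fintype.sum_option]
        exact h
    refine memAdd_of_stable_retract (ι := Unit) (fun _ => F.obj (pullObj π ξ)) (fun _ => hpull)
      (mem_add hB) (fun _ => F.map (st σ)) (fun _ => F.map (st ρ)) ?_
    simp [← Functor.map_comp, st_comp, hρσ, st_id]

/-- Stably equivalent algebras satisfy one inequality between extension dimensions. -/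
lemma extDim_le_of_equivalence (k : Type u) [CommRing k] [IsArtinianRing k] [Algebra k A]
    [Module.Finite k A] (e : StObj A ≌ StObj B) [e.functor.Additive] : extDim B ≤ extDim A := by
  refine sInf_le_sInf ?_
  rintro _ ⟨n, rfl, T, hT, h⟩
  obtain ⟨T', hT', hB, h'⟩ := exists_bracket_transfer k e T
  refine ⟨n, rfl, T', hT', fun Y hY => ?_⟩
  let Y' : StObj B := ⟨Y, hY⟩
  let X : StObj A := e.inverse.obj Y'
  rw [mem_bracket_succ]
  refine memAdd_of_stable_retract (X := Y') (ι := Unit) (fun _ => e.functor.obj X)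
    (fun _ => (mem_bracket_succ B T' n _).1 (h' n X (h X.M X.fin)))
    ((mem_bracket_succ B T' n _).1 (addOf_subset_bracket B T' n hB))
    (fun _ => e.counitIso.inv.app Y') (fun _ => e.counitIso.hom.app Y') ?_
  simp only [Finset.univ_unique, Finset.sum_singleton]
  exact e.counitIso.inv_hom_id_app Y'

end Equivalence

end Paper

open Paper in
/-- If two Artin algebras are stably equivalent (their stable module
categories modulo projectives are equivalent as additive categories), then
`ed(A) = ed(B)`. -/
theorem stmt9 (k : Type u) [CommRing k] [IsArtinianRing k]
    (A : Type u) [Ring A] [Algebra k A] [Module.Finite k A]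
    (B : Type u) [Ring B] [Algebra k B] [Module.Finite k B]
    (e : StObj A ≌ StObj B)
    (hadd : ∀ (X Y : StObj A) (f g : X ⟶ Y),
      e.functor.map (f + g) = e.functor.map f + e.functor.map g) :
    extDim A = extDim B := by
  have : IsNoetherianRing A := IsNoetherianRing.of_finite k A
  have : IsNoetherianRing B := IsNoetherianRing.of_finite k B
  have : e.functor.Additive := ⟨hadd _ _ _ _⟩
  have : e.symm.functor.Additive := e.inverse_additive
  exact le_antisymm (extDim_le_of_equivalence k e.symm) (extDim_le_of_equivalence k e)
end

section
/- Let A be an Artin algebra, F a derived equivalence D^b(A) → D^b(B) whose associated tilting complex T• ∈ K^b(proj A) is a radical complex concentrated in degrees −n, …, 0. Then the tilting complex associated to a quasi-inverse of F is isomorphic in K^b(proj B) to a complex concentrated in degrees 0, …, n; i.e., F(A) is isomorphic in D^b(B) to a complex 0 → T̄^0 → ⋯ → T̄^n → 0 of projective B-modules if and only if F^{-1}(B) is isomorphic in D^b(A) to a complex 0 → T^{-n} → ⋯ → T^0 → 0 of projective A-modules. -/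
universe u

open CategoryTheory

universe w v

namespace DerivedCategory

open Limits Pretriangulated

section Generic

variable {C : Type u} [Category.{v} C] [Abelian C] [HasDerivedCategory.{w} C]

lemma Q_map_surjective_of_isKProjective (K L : CochainComplex C ℤ) [K.IsKProjective] :
    Function.Surjective (Q.map : (K ⟶ L) → (Q.obj K ⟶ Q.obj L)) := by
  intro f
  obtain ⟨g, hg⟩ := (CochainComplex.IsKProjective.Qh_map_bijective K _).surjective
    ((quotientCompQhIso C).hom.app K ≫ f ≫ (quotientCompQhIso C).inv.app L)
  obtain ⟨g, rfl⟩ := (HomotopyCategory.quotient _ _).map_surjective g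
  refine ⟨g, ?_⟩
  rw [← cancel_epi ((quotientCompQhIso C).hom.app K), ← quotientCompQhIso_hom_naturality]
  erw [hg]
  simp

/-- The object `P` placed in degree `i`, as a complex. -/
noncomputable abbrev singleComplex (P : C) (i : ℤ) : CochainComplex C ℤ :=
  (HomologicalComplex.single C (.up ℤ) i).obj P

instance (P : C) [Projective P] (i : ℤ) : (singleComplex P i).IsKProjective := by
  have : ∀ j, Projective ((singleComplex P i).X j) := by
    intro j
    by_cases h : j = i
    · subst h
      exact Projective.of_iso (HomologicalComplex.singleObjXSelf (.up ℤ) j P).symm inferInstance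
    · exact (HomologicalComplex.isZero_single_obj_X (.up ℤ) i P j h).projective
  exact CochainComplex.isKProjective_of_projective _ i

/-- The homology of a complex, computed in the derived category. -/
noncomputable def homologyQIso (K : CochainComplex C ℤ) (i : ℤ) :
    (homologyFunctor C i).obj (Q.obj K) ≅ K.homology i :=
  (homologyFunctorFactors C i).app K

lemma homologyQIso_hom_naturality {K L : CochainComplex C ℤ} (φ : K ⟶ L) (i : ℤ) :
    (homologyFunctor C i).map (Q.map φ) ≫ (homologyQIso L i).hom =
      (homologyQIso K i).hom ≫ HomologicalComplex.homologyMap φ i :=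
  (homologyFunctorFactors C i).hom.naturality φ

/-- The isomorphism between `P` and the `i`th homology of `P` placed in degree `i`. -/
noncomputable def singleHomologyIso (P : C) (i : ℤ) :
    P ≅ (homologyFunctor C i).obj (Q.obj (singleComplex P i)) :=
  (HomologicalComplex.singleObjHomologySelfIso (.up ℤ) i P).symm ≪≫ (homologyQIso _ i).symm

lemma singleHomologyIso_hom_map (P : C) (i : ℤ) (K : CochainComplex C ℤ)
    (φ : singleComplex P i ⟶ K) :
    (singleHomologyIso P i).hom ≫ (homologyFunctor C i).map (Q.map φ) ≫ (homologyQIso K i).hom =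
    (HomologicalComplex.singleObjCyclesSelfIso (.up ℤ) i P).inv ≫
      HomologicalComplex.cyclesMap φ i ≫ K.homologyπ i := by
  rw [homologyQIso_hom_naturality, ← HomologicalComplex.homologyπ_naturality]
  simp only [singleHomologyIso, Iso.trans_hom, Category.assoc]
  rw [Iso.symm_hom, Iso.symm_hom, Iso.inv_hom_id_assoc,
    HomologicalComplex.singleObjCyclesSelfIso_inv_homologyπ_assoc]

lemma exists_from_single (P : C) [Projective P] (i : ℤ) (X : DerivedCategory C)
    (u : P ⟶ (homologyFunctor C i).obj X) :
    ∃ f : Q.obj (singleComplex P i) ⟶ X,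
      (singleHomologyIso P i).hom ≫ (homologyFunctor C i).map f = u := by
  let K := Q.objPreimage X
  let e : Q.obj K ≅ X := Q.objObjPreimageIso X
  let u' : P ⟶ K.homology i :=
    u ≫ (homologyFunctor C i).map e.inv ≫ (homologyQIso K i).hom
  let v : P ⟶ K.cycles i := Projective.factorThru u' (K.homologyπ i)
  have hv : v ≫ K.homologyπ i = u' := Projective.factorThru_comp _ _
  let φ : singleComplex P i ⟶ K :=
    HomologicalComplex.mkHomFromSingle (v ≫ K.iCycles i) (by simp)
  have hφ : (HomologicalComplex.singleObjCyclesSelfIso (.up ℤ) i P).inv ≫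
      HomologicalComplex.cyclesMap φ i = v := by
    rw [← cancel_mono (K.iCycles i)]
    simp [φ]
  have := singleHomologyIso_hom_map P i K φ
  rw [reassoc_of% hφ, hv] at this
  refine ⟨Q.map φ ≫ e.hom, ?_⟩
  rw [← cancel_mono ((homologyFunctor C i).map e.inv),
    ← cancel_mono ((homologyQIso K i).hom)]
  rw [Functor.map_comp, Category.assoc]
  simpa [u'] using this

lemma from_single_eq_zero {P : C} [Projective P] {i : ℤ} {X : DerivedCategory C}
    (f : Q.obj (singleComplex P i) ⟶ X) (hf : (homologyFunctor C i).map f = 0) : f = 0 := by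
  let K := Q.objPreimage X
  let e : Q.obj K ≅ X := Q.objObjPreimageIso X
  obtain ⟨φ, hφ⟩ := Q_map_surjective_of_isKProjective (singleComplex P i) K (f ≫ e.inv)
  have h := singleHomologyIso_hom_map P i K φ
  rw [hφ, Functor.map_comp, hf, zero_comp, zero_comp, comp_zero] at h
  let v := (HomologicalComplex.singleObjCyclesSelfIso (.up ℤ) i P).inv ≫
    HomologicalComplex.cyclesMap φ i
  have hv : v ≫ K.homologyπ i = 0 := by
    simpa only [v, Category.assoc] using h.symm
  let S := ShortComplex.mk (K.toCycles (i - 1) i) (K.homologyπ i) (by simp)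
  have hS : S.Exact := S.exact_of_g_is_cokernel (K.homologyIsCokernel (i - 1) i (by simp))
  let l : P ⟶ K.X (i - 1) := hS.liftFromProjective v hv
  have hl : l ≫ K.toCycles (i - 1) i = v := hS.liftFromProjective_comp v hv
  have hl' : φ.f i = (HomologicalComplex.singleObjXSelf (.up ℤ) i P).hom ≫ l ≫ K.d (i - 1) i := by
    rw [← K.toCycles_i, reassoc_of% hl]
    simp [v]
  have hz : Homotopy φ 0 :=
    { hom := fun p q => if h : p = i ∧ q = i - 1 then
        eqToHom (by rw [h.1]) ≫ (HomologicalComplex.singleObjXSelf (.up ℤ) i P).hom ≫ l ≫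
          eqToHom (by rw [h.2]) else 0
      zero := by
        intro p q hpq
        rw [dif_neg]
        rintro ⟨rfl, rfl⟩
        simp at hpq
      comm := by
        intro p
        by_cases hp : p = i
        · subst hp
          rw [dNext_eq _ (show (ComplexShape.up ℤ).Rel p (p + 1) by simp),
            prevD_eq _ (show (ComplexShape.up ℤ).Rel (p - 1) p by simp)]
          simp [hl']
        · exact (HomologicalComplex.isZero_single_obj_X (.up ℤ) i P p hp).eq_of_src _ _ }
  rw [← cancel_mono e.inv, ← hφ, Q_map_eq_of_homotopy _ hz, Q.map_zero, zero_comp]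

end Generic

section Shift

variable {C : Type u} [Category.{v} C] [Abelian C] [HasDerivedCategory.{w} C]

/-- Shifting an object placed in a single degree. -/
noncomputable def singleShiftIso (P : C) (m i i' : ℤ) (h : m + i = i') :
    (Q.obj (singleComplex P i'))⟦m⟧ ≅ Q.obj (singleComplex P i) :=
  (Q.commShiftIso m).symm.app _ ≪≫
    Q.mapIso (((CochainComplex.singleFunctors C).shiftIso m i i' h).app P)

end Shift

section Module

variable {R : Type u} [Ring R]

/-- The finitely generated projective modules. -/
def fgProj (R : Type u) [Ring R] : ObjectProperty (ModuleCat.{u} R) :=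
  fun M => Module.Finite R M ∧ Module.Projective R M

lemma fgProj_self : fgProj R (ModuleCat.of R R) :=
  ⟨inferInstanceAs (Module.Finite R R), inferInstanceAs (Module.Projective R R)⟩

lemma fgProj.of_iso {M N : ModuleCat.{u} R} (e : M ≅ N) (h : fgProj R M) : fgProj R N := by
  obtain ⟨_, _⟩ := h
  exact ⟨Module.Finite.equiv e.toLinearEquiv, Module.Projective.of_equiv e.toLinearEquiv⟩

lemma fgProj.of_isZero {M : ModuleCat.{u} R} (h : IsZero M) : fgProj R M := by
  have := ModuleCat.subsingleton_of_isZero h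
  have := Module.Free.of_subsingleton R M
  exact ⟨inferInstance, Module.Projective.of_free⟩

lemma fgProj.biprod {M N : ModuleCat.{u} R} (hM : fgProj R M) (hN : fgProj R N) :
    fgProj R (M ⊞ N) := by
  obtain ⟨_, _⟩ := hM
  obtain ⟨_, _⟩ := hN
  refine fgProj.of_iso (ModuleCat.biprodIsoProd M N).symm ⟨?_, ?_⟩
  · exact inferInstanceAs (Module.Finite R (M × N))
  · exact inferInstanceAs (Module.Projective R (M × N))

lemma fgProj.of_retract {M N : ModuleCat.{u} R} (r : Retract N M) (h : fgProj R M) :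
    fgProj R N := by
  obtain ⟨_, _⟩ := h
  have hr : Function.LeftInverse r.r r.i := fun x => by
    rw [← ModuleCat.comp_apply, r.retract]; rfl
  exact ⟨Module.Finite.of_surjective r.r.hom hr.surjective,
    Module.Projective.of_split r.i.hom r.r.hom (LinearMap.ext hr)⟩

lemma fgProj.projective {M : ModuleCat.{u} R} (h : fgProj R M) : Projective M := by
  obtain ⟨_, _⟩ := h
  exact M.projective_of_categoryTheory_projective

/-- A complex of finitely generated projective modules in degrees `a, …, b`. -/
structure IsPerfComplex (a b : ℤ) (T : CochainComplex (ModuleCat.{u} R) ℤ) : Prop where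
  fgProj (i : ℤ) : fgProj R (T.X i)
  isZero (i : ℤ) (h : i < a ∨ b < i) : IsZero (T.X i)

lemma IsPerfComplex.isStrictlyLE {a b : ℤ} {T : CochainComplex (ModuleCat.{u} R) ℤ}
    (h : IsPerfComplex a b T) : T.IsStrictlyLE b := by
  rw [CochainComplex.isStrictlyLE_iff]
  exact fun i hi => h.isZero i (Or.inr hi)

lemma IsPerfComplex.isKProjective {a b : ℤ} {T : CochainComplex (ModuleCat.{u} R) ℤ}
    (h : IsPerfComplex a b T) : T.IsKProjective := by
  have := h.isStrictlyLE
  have (i : ℤ) : Projective (T.X i) := (h.fgProj i).projective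
  exact CochainComplex.isKProjective_of_projective T b

variable [HasDerivedCategory.{w} (ModuleCat.{u} R)]

/-- An object of the derived category that is represented by a complex of finitely generated
projective modules in degrees `a, …, b`. -/
def IsPerf (a b : ℤ) (X : DerivedCategory (ModuleCat.{u} R)) : Prop :=
  ∃ T, IsPerfComplex a b T ∧ Nonempty (X ≅ Q.obj T)

lemma IsPerf.of_iso {a b : ℤ} {X Y : DerivedCategory (ModuleCat.{u} R)} (e : X ≅ Y)
    (h : IsPerf a b X) : IsPerf a b Y := by
  obtain ⟨T, hT, ⟨e'⟩⟩ := h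
  exact ⟨T, hT, ⟨e.symm ≪≫ e'⟩⟩

lemma IsPerf.mono {a b a' b' : ℤ} {X : DerivedCategory (ModuleCat.{u} R)} (h : IsPerf a b X)
    (ha : a' ≤ a) (hb : b ≤ b') : IsPerf a' b' X := by
  obtain ⟨T, hT, e⟩ := h
  exact ⟨T, ⟨hT.fgProj, fun i hi => hT.isZero i (by lia)⟩, e⟩

lemma IsPerf.shift {a b : ℤ} {X : DerivedCategory (ModuleCat.{u} R)} (h : IsPerf a b X)
    (m a' b' : ℤ) (ha : m + a' = a) (hb : m + b' = b) : IsPerf a' b' (X⟦m⟧) := by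
  obtain ⟨T, hT, ⟨e⟩⟩ := h
  refine ⟨T⟦m⟧, ⟨fun i => hT.fgProj (i + m), fun i hi => hT.isZero (i + m) (by lia)⟩,
    ⟨(shiftFunctor _ m).mapIso e ≪≫ (Q.commShiftIso m).symm.app _⟩⟩

lemma isPerf_single {a b i : ℤ} (ha : a ≤ i) (hb : i ≤ b) {P : ModuleCat.{u} R}
    (h : fgProj R P) : IsPerf a b (Q.obj (singleComplex P i)) := by
  have hz (j : ℤ) (hj : j ≠ i) : IsZero ((singleComplex P i).X j) :=
    HomologicalComplex.isZero_single_obj_X (.up ℤ) i P j hj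
  refine ⟨_, ⟨fun j => ?_, fun j hj => hz j (by lia)⟩, ⟨Iso.refl _⟩⟩
  by_cases hj : j = i
  · subst hj
    exact h.of_iso (HomologicalComplex.singleObjXSelf (.up ℤ) j P).symm
  · exact .of_isZero (hz j hj)

lemma IsPerf.cone {a b : ℤ} (T : Triangle (DerivedCategory (ModuleCat.{u} R)))
    (hT : T ∈ distTriang _) (h₁ : IsPerf (a + 1) (b + 1) T.obj₁) (h₂ : IsPerf a b T.obj₂) :
    IsPerf a b T.obj₃ := by
  obtain ⟨K, hK, ⟨e₁⟩⟩ := h₁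
  obtain ⟨L, hL, ⟨e₂⟩⟩ := h₂
  have := hK.isKProjective
  obtain ⟨φ, hφ⟩ := Q_map_surjective_of_isKProjective K L (e₁.inv ≫ T.mor₁ ≫ e₂.hom)
  have comm : T.mor₁ ≫ e₂.hom = e₁.hom ≫ Q.map φ := by rw [hφ, Iso.hom_inv_id_assoc]
  let e := isoTriangleOfIso₁₂ _ _ hT (mappingCone_triangle_distinguished φ) e₁ e₂ comm
  have hX (i : ℤ) : (CochainComplex.mappingCone φ).X i ≅ K.X (i + 1) ⊞ L.X i :=
    HomologicalComplex.homotopyCofiber.XIsoBiprod φ i (i + 1) rfl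
  refine ⟨CochainComplex.mappingCone φ, ⟨fun i => ?_, fun i hi => ?_⟩,
    ⟨Triangle.π₃.mapIso e⟩⟩
  · exact ((hK.fgProj _).biprod (hL.fgProj _)).of_iso (hX i).symm
  · exact (biprod_isZero_iff _ _ |>.2 ⟨hK.isZero _ (by lia), hL.isZero _ hi⟩).of_iso (hX i)

lemma IsPerf.isLE {a b : ℤ} {X : DerivedCategory (ModuleCat.{u} R)} (h : IsPerf a b X) :
    X.IsLE b := by
  obtain ⟨T, hT, ⟨e⟩⟩ := h
  have := hT.isStrictlyLE
  exact TStructure.t.isLE_of_iso e.symm b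

end Module

section Resolution

section

variable {C : Type u} [Category.{v} C] [Abelian C] [HasDerivedCategory.{w} C]

lemma isZero_homology_single (P : C) {i j : ℤ} (h : j ≠ i) :
    IsZero ((homologyFunctor C j).obj (Q.obj (singleComplex P i))) :=
  (HomologicalComplex.isZero_single_obj_homology (.up ℤ) i P j h).of_iso (homologyQIso _ j)

lemma isLE_single (P : C) (i : ℤ) : (Q.obj (singleComplex P i)).IsLE i := by
  rw [isLE_iff]
  exact fun j hj => isZero_homology_single P hj.ne'

lemma isLE_obj₃_of_epi (T : Triangle (DerivedCategory C)) (hT : T ∈ distTriang _) (c : ℤ)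
    (h₁ : T.obj₁.IsLE c) (h₂ : T.obj₂.IsLE c) (h : Epi ((homologyFunctor C c).map T.mor₁)) :
    T.obj₃.IsLE (c - 1) := by
  rw [isLE_iff]
  intro i hi
  refine (HomologySequence.exact₃ T hT i (i + 1)).isZero_of_both_zeros ?_ ?_
  · obtain rfl | hi : c = i ∨ c < i := by lia
    · exact (HomologySequence.epi_homologyMap_mor₁_iff T hT c).1 h
    · exact (isZero_of_isLE T.obj₂ c i hi).eq_zero_of_src _
  · exact (isZero_of_isLE T.obj₁ c (i + 1) (by lia)).eq_zero_of_tgt _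

end

variable {R : Type u} [Ring R]

lemma _root_.CategoryTheory.ShortComplex.Exact.finite_X₂
    [IsNoetherianRing R] {S : ShortComplex (ModuleCat.{u} R)}
    (hS : S.Exact) [Module.Finite R S.X₁] [Module.Finite R S.X₃] : Module.Finite R S.X₂ := by
  have := isNoetherian_of_isNoetherianRing_of_finite R S.X₁
  have := isNoetherian_of_isNoetherianRing_of_finite R S.X₃
  have := isNoetherian_of_range_eq_ker S.f.hom S.g.hom
    ((ShortComplex.moduleCat_exact_iff_range_eq_ker S).1 hS)
  infer_instance

variable [HasDerivedCategory.{w} (ModuleCat.{u} R)]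

/-- All homology modules are finitely generated. -/
def HasFiniteHomology (X : DerivedCategory (ModuleCat.{u} R)) : Prop :=
  ∀ i, Module.Finite R ((homologyFunctor (ModuleCat.{u} R) i).obj X)


lemma hasFiniteHomology_single {P : ModuleCat.{u} R} (hP : Module.Finite R P) (i : ℤ) :
    HasFiniteHomology (Q.obj (singleComplex P i)) := by
  intro j
  by_cases h : j = i
  · subst h
    exact Module.Finite.equiv (singleHomologyIso P j).toLinearEquiv
  · have := ModuleCat.subsingleton_of_isZero (isZero_homology_single P h)
    infer_instance

lemma isPerf_of_isGE {c : ℤ} {X : DerivedCategory (ModuleCat.{u} R)} [X.IsGE c] [X.IsLE c]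
    (h : fgProj R ((homologyFunctor (ModuleCat.{u} R) c).obj X)) : IsPerf c c X := by
  obtain ⟨M, ⟨e⟩⟩ := exists_iso_singleFunctor_obj_of_isGE_of_isLE X c
  have e' : X ≅ Q.obj (singleComplex M c) := e
  exact (isPerf_single le_rfl le_rfl (h.of_iso
    ((homologyFunctor (ModuleCat.{u} R) c).mapIso e' ≪≫ (singleHomologyIso M c).symm))).of_iso e'.symm

/-- A morphism from a finitely generated free module in degree `c` which is surjective on the
homology in degree `c`. -/
lemma exists_single_epi (X : DerivedCategory (ModuleCat.{u} R)) (c : ℤ)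
    (h : Module.Finite R ((homologyFunctor (ModuleCat.{u} R) c).obj X)) :
    ∃ (P : ModuleCat.{u} R) (_ : fgProj R P) (f : Q.obj (singleComplex P c) ⟶ X),
      Epi ((homologyFunctor (ModuleCat.{u} R) c).map f) := by
  obtain ⟨r, g, hg⟩ := Module.Finite.exists_fin' R ((homologyFunctor (ModuleCat.{u} R) c).obj X)
  have hP : fgProj R (ModuleCat.of R (Fin r → R)) :=
    ⟨inferInstanceAs (Module.Finite R (Fin r → R)),
      inferInstanceAs (Module.Projective R (Fin r → R))⟩
  have := hP.projective
  let u : ModuleCat.of R (Fin r → R) ⟶ (homologyFunctor (ModuleCat.{u} R) c).obj X := ModuleCat.ofHom g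
  have : Epi u := (ModuleCat.epi_iff_surjective u).2 hg
  obtain ⟨f, hf⟩ := exists_from_single _ c X u
  exact ⟨_, hP, f, epi_of_epi_fac hf⟩

variable [IsNoetherianRing R]

lemma HasFiniteHomology.obj₃ (T : Triangle (DerivedCategory (ModuleCat.{u} R)))
    (hT : T ∈ distTriang _) (h₁ : HasFiniteHomology T.obj₁) (h₂ : HasFiniteHomology T.obj₂) :
    HasFiniteHomology T.obj₃ := by
  intro i
  have := h₁ (i + 1)
  have := h₂ i
  exact (HomologySequence.exact₃ T hT i (i + 1)).finite_X₂

theorem isPerf_of_hom_eq_zero (a : ℤ) (m : ℕ) (c : ℤ) (hc : a + m = c)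
    (X : DerivedCategory (ModuleCat.{u} R)) [X.IsLE c]
    (hfin : HasFiniteHomology X)
    (hX : ∀ (Y : DerivedCategory (ModuleCat.{u} R)) (_ : Y.IsLE (a - 1)) (f : X ⟶ Y), f = 0) :
    IsPerf a c X := by
  induction m generalizing X c with
  | zero =>
    obtain rfl : a = c := by simpa using hc
    obtain ⟨P, hP, f, hf⟩ := exists_single_epi X a (hfin a)
    obtain ⟨Y, g, h, hT⟩ := distinguished_cocone_triangle f
    have hY : Y.IsLE (a - 1) := isLE_obj₃_of_epi _ hT a (isLE_single P a) ‹_› hf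
    have hg : 𝟙 X ≫ g = 0 := by rw [hX Y hY g, comp_zero]
    obtain ⟨s, hs⟩ : ∃ s : X ⟶ Q.obj (singleComplex P a), 𝟙 X = s ≫ f :=
      Triangle.coyoneda_exact₂ _ hT (𝟙 X) hg
    let r : Retract X (Q.obj (singleComplex P a)) := ⟨s, f, hs.symm⟩
    have hr (i : ℤ) := r.map (homologyFunctor (ModuleCat.{u} R) i)
    have : X.IsGE a := by
      rw [isGE_iff]
      intro i hi
      have hz := isZero_homology_single P (i := a) (j := i) hi.ne
      rw [IsZero.iff_id_eq_zero, ← (hr i).retract, hz.eq_zero_of_src (hr i).r, comp_zero]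
    exact isPerf_of_isGE (.of_retract (hr a) (hP.of_iso (singleHomologyIso P a)))
  | succ m ih =>
    push_cast at hc
    obtain ⟨P, hP, f, hf⟩ := exists_single_epi X c (hfin c)
    have := hP.projective
    obtain ⟨Y, g, h, hT⟩ := distinguished_cocone_triangle f
    have hY : Y.IsLE (c - 1) := isLE_obj₃_of_epi _ hT c (isLE_single P c) ‹_› hf
    have hY' : IsPerf a (c - 1) Y := by
      refine ih (c - 1) (by lia) Y
        (.obj₃ _ hT (hasFiniteHomology_single hP.1 c) hfin) (fun Z hZ φ => ?_)
      obtain ⟨ψ, hψ⟩ : ∃ ψ : (Q.obj (singleComplex P c))⟦(1 : ℤ)⟧ ⟶ Z, φ = h ≫ ψ :=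
        Triangle.yoneda_exact₃ _ hT φ (hX Z hZ _)
      let e := singleShiftIso P 1 (c - 1) c (by lia)
      have h0 : e.inv ≫ ψ = 0 := from_single_eq_zero _
        ((isZero_of_isLE Z (a - 1) (c - 1) (by lia)).eq_zero_of_tgt _)
      have h1 : ψ = 0 := by rw [← cancel_epi e.inv, h0, comp_zero]
      rw [hψ, h1, comp_zero]
    exact IsPerf.cone _ (inv_rot_of_distTriang _ hT)
      ((hY'.shift (-1) (a + 1) c (by lia) (by lia)).mono le_rfl (by lia))
      (isPerf_single (by lia) le_rfl hP)

end Resolution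

section FinGen

/-- The morphisms `U ⟶ V` are generated by finitely many of them under precomposition with the
endomorphisms of `U`. -/
def FinGenHom {C : Type*} [Category* C] [Preadditive C] (U V : C) : Prop :=
  ∃ (r : ℕ) (g : Fin r → (U ⟶ V)), ∀ f : U ⟶ V, ∃ e : Fin r → (U ⟶ U), f = ∑ j, e j ≫ g j

lemma FinGenHom.of_iso {C : Type*} [Category* C] [Preadditive C] {U U' V : C} (i : U ≅ U')
    (h : FinGenHom U V) : FinGenHom U' V := by
  obtain ⟨r, g, hg⟩ := h
  refine ⟨r, fun j => i.inv ≫ g j, fun f => ?_⟩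
  obtain ⟨e, he⟩ := hg (i.hom ≫ f)
  refine ⟨fun j => i.inv ≫ e j ≫ i.hom, ?_⟩
  rw [← cancel_epi i.hom, he, Preadditive.comp_sum]
  simp

lemma FinGenHom.of_equivalence {C D : Type*} [Category* C] [Category* D] [Preadditive C]
    [Preadditive D] (F : C ≌ D) [F.functor.Additive] {U : C} {V : D}
    (h : FinGenHom (F.functor.obj U) V) : FinGenHom U (F.inverse.obj V) := by
  obtain ⟨r, g, hg⟩ := h
  let φ := F.toAdjunction.homAddEquiv U V
  refine ⟨r, fun j => φ (g j), fun f => ?_⟩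
  obtain ⟨e, he⟩ := hg (φ.symm f)
  refine ⟨fun j => F.functor.preimage (e j), ?_⟩
  rw [← φ.apply_symm_apply f, he, map_sum]
  refine Finset.sum_congr rfl fun j _ => ?_
  have := F.toAdjunction.homEquiv_naturality_left (F.functor.preimage (e j)) (g j)
  rwa [F.functor.map_preimage] at this

variable {R : Type u} [Ring R]

/-- Multiplication by a scalar, as an endomorphism of a complex of modules. -/
def scalarEnd {k : Type*} [CommRing k] [Algebra k R] (c : k)
    (T : CochainComplex (ModuleCat.{u} R) ℤ) : T ⟶ T where
  f i := ModuleCat.ofHom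
    { toFun := fun t => algebraMap k R c • t
      map_add' := fun _ _ => smul_add _ _ _
      map_smul' := fun r t => by
        rw [RingHom.id_apply, smul_smul, smul_smul, Algebra.commutes] }
  comm' i j _ := by
    ext t
    exact (T.d i j).hom.map_smul _ _

lemma exists_eq_sum_scalarEnd (k : Type*) [CommRing k] [IsNoetherianRing k] [Algebra k R]
    [Module.Finite k R] (T : CochainComplex (ModuleCat.{u} R) ℤ) (i : ℤ)
    [Module.Finite R (T.X i)] :
    ∃ (r : ℕ) (g : Fin r → (T ⟶ singleComplex (ModuleCat.of R R) i)),
      ∀ f, ∃ c : Fin r → k, f = ∑ j, scalarEnd (c j) T ≫ g j := by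
  obtain ⟨p, s, hs⟩ := Module.Finite.exists_fin (R := R) (M := T.X i)
  let ev : (T ⟶ singleComplex (ModuleCat.of R R) i) →+ (Fin p → R) :=
    { toFun := fun f l =>
        (f.f i ≫ (HomologicalComplex.singleObjXSelf (.up ℤ) i (ModuleCat.of R R)).hom).hom (s l)
      map_zero' := by
        ext l
        simp
      map_add' := fun f g => by
        ext l
        simp [Preadditive.add_comp] }
  have hev : Function.Injective ev := by
    intro f g hfg
    apply HomologicalComplex.to_single_hom_ext
    rw [← cancel_mono (HomologicalComplex.singleObjXSelf (.up ℤ) i (ModuleCat.of R R)).hom]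
    apply ModuleCat.hom_ext
    apply LinearMap.ext_on_range hs
    exact fun l => congrFun hfg l
  have hsmul (c : k) (f) : ev (scalarEnd c T ≫ f) = c • ev f := by
    ext l
    rw [Pi.smul_apply, Algebra.smul_def]
    exact (f.f i ≫ (HomologicalComplex.singleObjXSelf (.up ℤ) i
      (ModuleCat.of R R)).hom).hom.map_smul _ _
  let W : Submodule k (Fin p → R) :=
    { toAddSubmonoid := AddMonoidHom.mrange ev
      smul_mem' := by
        rintro c _ ⟨f, rfl⟩
        exact ⟨scalarEnd c T ≫ f, hsmul c f⟩ }
  have : IsNoetherian k R := isNoetherian_of_isNoetherianRing_of_finite k R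
  obtain ⟨r, x, hx⟩ := Submodule.fg_iff_exists_fin_generating_family.1 (IsNoetherian.noetherian W)
  have hxW (j : Fin r) : ∃ g, ev g = x j := by
    have : x j ∈ W := hx ▸ Submodule.subset_span ⟨j, rfl⟩
    exact this
  choose g hg using hxW
  refine ⟨r, g, fun f => ?_⟩
  have hf : ev f ∈ Submodule.span k (Set.range x) := hx ▸ ⟨f, rfl⟩
  obtain ⟨c, hc⟩ := (Submodule.mem_span_range_iff_exists_fun k).1 hf
  refine ⟨c, hev ?_⟩
  rw [map_sum, ← hc]
  exact Finset.sum_congr rfl fun j _ => by rw [hsmul, hg]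

lemma moduleCat_sum_apply {ι : Type*} [Fintype ι] {M N : ModuleCat.{u} R} (f : ι → (M ⟶ N))
    (x : M) : (∑ j, f j) x = ∑ j, f j x := by
  change (∑ j, f j).hom x = _
  rw [ModuleCat.hom_sum, LinearMap.sum_apply]

variable [HasDerivedCategory.{w} (ModuleCat.{u} R)]

lemma IsPerf.finGenHom (k : Type*) [CommRing k] [IsNoetherianRing k] [Algebra k R]
    [Module.Finite k R] {a b : ℤ} {U : DerivedCategory (ModuleCat.{u} R)} (h : IsPerf a b U)
    (i : ℤ) : FinGenHom U (Q.obj (singleComplex (ModuleCat.of R R) i)) := by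
  obtain ⟨T, hT, ⟨e⟩⟩ := h
  refine FinGenHom.of_iso e.symm ?_
  have := (hT.fgProj i).1
  have := hT.isKProjective
  obtain ⟨r, g, hg⟩ := exists_eq_sum_scalarEnd k T i
  refine ⟨r, fun j => Q.map (g j), fun f => ?_⟩
  obtain ⟨f, rfl⟩ := Q_map_surjective_of_isKProjective _ _ f
  obtain ⟨c, rfl⟩ := hg f
  refine ⟨fun j => Q.map (scalarEnd (c j) T), ?_⟩
  rw [Functor.map_sum]
  simp

lemma IsPerf.hom_single_eq_zero {a b : ℤ} {U : DerivedCategory (ModuleCat.{u} R)}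
    (h : IsPerf a b U) {i : ℤ} (hi : i < a) {P : ModuleCat.{u} R}
    (f : U ⟶ Q.obj (singleComplex P i)) : f = 0 := by
  obtain ⟨T, hT, ⟨e⟩⟩ := h
  have := hT.isKProjective
  obtain ⟨g, hg⟩ := Q_map_surjective_of_isKProjective _ _ (e.inv ≫ f)
  have : g = 0 := HomologicalComplex.to_single_hom_ext ((hT.isZero i (.inl hi)).eq_of_src _ _)
  rw [← cancel_epi e.inv, ← hg, this, Functor.map_zero, comp_zero]

lemma exists_from_single_ring (X : DerivedCategory (ModuleCat.{u} R)) (i : ℤ)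
    (x : (homologyFunctor (ModuleCat.{u} R) i).obj X) :
    ∃ f : Q.obj (singleComplex (ModuleCat.of R R) i) ⟶ X,
      (homologyFunctor (ModuleCat.{u} R) i).map f
        ((singleHomologyIso (ModuleCat.of R R) i).hom (1 : R)) = x := by
  have : Projective (ModuleCat.of R R) := ModuleCat.projective_of_categoryTheory_projective _
  obtain ⟨f, hf⟩ := exists_from_single (ModuleCat.of R R) i X
    (ModuleCat.ofHom (LinearMap.toSpanSingleton R _ x))
  refine ⟨f, ?_⟩
  exact (congrArg (fun φ => φ.hom (1 : R)) hf).trans (one_smul R x)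

lemma isZero_homology_of_hom_eq_zero {X : DerivedCategory (ModuleCat.{u} R)} {i : ℤ}
    (h : ∀ f : Q.obj (singleComplex (ModuleCat.of R R) i) ⟶ X, f = 0) :
    IsZero ((homologyFunctor (ModuleCat.{u} R) i).obj X) := by
  rw [ModuleCat.isZero_iff_subsingleton]
  refine subsingleton_of_forall_eq 0 fun x => ?_
  obtain ⟨f, rfl⟩ := exists_from_single_ring X i x
  rw [h f, Functor.map_zero]
  rfl

lemma FinGenHom.finite_homology {X : DerivedCategory (ModuleCat.{u} R)} {i : ℤ}
    (h : FinGenHom (Q.obj (singleComplex (ModuleCat.of R R) i)) X) :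
    Module.Finite R ((homologyFunctor (ModuleCat.{u} R) i).obj X) := by
  obtain ⟨r, g, hg⟩ := h
  let H := homologyFunctor (ModuleCat.{u} R) i
  let σ := singleHomologyIso (ModuleCat.of R R) i
  let y (j : Fin r) : H.obj X := H.map (g j) (σ.hom (1 : R))
  refine ⟨Submodule.fg_iff_exists_fin_generating_family.2 ⟨r, y, top_le_iff.1 fun x _ => ?_⟩⟩
  obtain ⟨f, hf⟩ := exists_from_single_ring X i x
  obtain ⟨e, rfl⟩ := hg f
  rw [Submodule.mem_span_range_iff_exists_fun]
  let z (j : Fin r) := H.map (e j) (σ.hom (1 : R))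
  refine ⟨fun j => σ.inv (z j), ?_⟩
  rw [← hf, Functor.map_sum]
  refine Eq.trans ?_ (moduleCat_sum_apply (fun j => H.map (e j ≫ g j)) (σ.hom (1 : R))).symm
  refine Finset.sum_congr rfl fun j _ => ?_
  have h₁ : σ.inv (z j) • σ.hom (1 : R) = z j := by
    rw [← map_smul]
    refine Eq.trans ?_ (σ.inv_hom_id_apply (z j))
    exact congrArg σ.hom (mul_one (M := R) (σ.inv (z j)))
  rw [Functor.map_comp]
  change _ • H.map (g j) (σ.hom (1 : R)) = H.map (g j) (z j)
  rw [← map_smul, h₁]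

end FinGen

section Equivalence

lemma isPerf_iff {R : Type u} [Ring R] [HasDerivedCategory.{w} (ModuleCat.{u} R)] (a b : ℤ)
    (X : DerivedCategory (ModuleCat.{u} R)) :
    IsPerf a b X ↔ ∃ T : CochainComplex (ModuleCat.{u} R) ℤ,
      (∀ i, Module.Finite R (T.X i)) ∧ (∀ i, Module.Projective R (T.X i)) ∧
      (∀ i : ℤ, (i < a ∨ b < i) → Subsingleton (T.X i)) ∧ Nonempty (X ≅ Q.obj T) := by
  simp only [← ModuleCat.isZero_iff_subsingleton]
  constructor
  · rintro ⟨T, hT, e⟩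
    exact ⟨T, fun i => (hT.fgProj i).1, fun i => (hT.fgProj i).2, hT.isZero, e⟩
  · rintro ⟨T, h₁, h₂, h₃, e⟩
    exact ⟨T, ⟨fun i => ⟨h₁ i, h₂ i⟩, h₃⟩, e⟩

lemma isLE_of_retract {C : Type*} [Category* C] [Abelian C] [HasDerivedCategory.{w} C]
    {X Y : DerivedCategory C} (r : Retract X Y) (n : ℤ) [Y.IsLE n] : X.IsLE n := by
  rw [isLE_iff]
  intro i hi
  let r' := r.map (homologyFunctor C i)
  rw [IsZero.iff_id_eq_zero, ← r'.retract, (isZero_of_isLE Y n i hi).eq_zero_of_src r'.r, comp_zero]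

lemma hom_inverse_eq_zero {C D : Type*} [Category* C] [Category* D] [Preadditive C]
    [Preadditive D] (F : C ≌ D) [F.functor.Additive] {U : C} {V : D}
    (h : ∀ f : F.functor.obj U ⟶ V, f = 0) (f : U ⟶ F.inverse.obj V) : f = 0 :=
  (F.toAdjunction.homAddEquiv U V).symm.map_eq_zero_iff.1 (h _)

lemma hom_functor_eq_zero {C D : Type*} [Category* C] [Category* D] [Preadditive C]
    [Preadditive D] (F : C ≌ D) [F.functor.Additive] {U : C} {V : D}
    (h : ∀ f : U ⟶ F.inverse.obj V, f = 0) (f : F.functor.obj U ⟶ V) : f = 0 :=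
  (F.toAdjunction.homAddEquiv U V).map_eq_zero_iff.1 (h _)

variable {A B : Type u} [Ring A] [Ring B] [HasDerivedCategory.{w} (ModuleCat.{u} A)]
  [HasDerivedCategory.{w} (ModuleCat.{u} B)]
  (F : DerivedCategory (ModuleCat.{u} A) ≌ DerivedCategory (ModuleCat.{u} B))

variable [F.functor.CommShift ℤ] {F} {a b : ℤ}

lemma isPerf_functor_obj_single
    (h : IsPerf a b (F.functor.obj (Q.obj (singleComplex (ModuleCat.of A A) 0)))) (i : ℤ) : IsPerf (a + i) (b + i)
    (F.functor.obj (Q.obj (singleComplex (ModuleCat.of A A) i))) :=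
  (h.shift (-i) (a + i) (b + i) (by lia) (by lia)).of_iso
    ((F.functor.commShiftIso (-i)).symm.app _ ≪≫
      F.functor.mapIso (singleShiftIso (ModuleCat.of A A) (-i) i 0 (by lia)))

variable [F.functor.Additive]

lemma isGE_inverse_obj
    (h : IsPerf a b (F.functor.obj (Q.obj (singleComplex (ModuleCat.of A A) 0))))
    (Z : DerivedCategory (ModuleCat.{u} B)) (m : ℤ) [Z.IsGE (b + m)] :
    (F.inverse.obj Z).IsGE m := by
  rw [isGE_iff]
  intro i hi
  refine isZero_homology_of_hom_eq_zero (hom_inverse_eq_zero F fun f => ?_)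
  have := (isPerf_functor_obj_single h i).isLE
  exact TStructure.t.zero f (b + i) (b + m)

lemma isLE_functor_obj
    (h : IsPerf a b (F.functor.obj (Q.obj (singleComplex (ModuleCat.of A A) 0))))
    (Y : DerivedCategory (ModuleCat.{u} A)) (m : ℤ) [Y.IsLE m] :
    (F.functor.obj Y).IsLE (b + m) := by
  obtain ⟨W, Z, hW, hZ, f, g, δ, hT⟩ := TStructure.t.exists_triangle (F.functor.obj Y)
    (b + m) (b + (m + 1)) (by lia)
  have : W.IsLE (b + m) := ⟨hW⟩
  have : Z.IsGE (b + (m + 1)) := ⟨hZ⟩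
  have := isGE_inverse_obj h Z (m + 1)
  have hg : g = 0 := hom_functor_eq_zero F (fun φ => TStructure.t.zero φ m (m + 1)) g
  obtain ⟨s, hs⟩ : ∃ s : F.functor.obj Y ⟶ W, 𝟙 _ = s ≫ f :=
    Triangle.coyoneda_exact₂ _ hT (𝟙 (F.functor.obj Y)) (by
      change 𝟙 _ ≫ g = 0
      rw [hg, comp_zero])
  exact isLE_of_retract ⟨s, f, hs.symm⟩ (b + m)

/-- If an equivalence sends `A` to a complex of finitely generated projective modules in degrees
`a, …, b`, then a quasi-inverse sends `B` to such a complex in degrees `-b, …, -a`. -/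
theorem isPerf_inverse_obj
    (h : IsPerf a b (F.functor.obj (Q.obj (singleComplex (ModuleCat.of A A) 0))))
    (k : Type*) [CommRing k] [IsNoetherianRing k] [Algebra k A]
    [Module.Finite k A] [Algebra k B] [Module.Finite k B] (hab : a ≤ b) :
    IsPerf (-b) (-a) (F.inverse.obj (Q.obj (singleComplex (ModuleCat.of B B) 0))) := by
  have : IsNoetherianRing A := IsNoetherianRing.of_finite k A
  have : Projective (ModuleCat.of B B) := fgProj_self.projective
  have hLE : (F.inverse.obj (Q.obj (singleComplex (ModuleCat.of B B) 0))).IsLE (-a) := by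
    rw [isLE_iff]
    exact fun i hi => isZero_homology_of_hom_eq_zero (hom_inverse_eq_zero F
      fun f => (isPerf_functor_obj_single h i).hom_single_eq_zero (by lia) f)
  refine isPerf_of_hom_eq_zero (-b) (b - a).toNat (-a) (by lia) _
    (fun i => (((isPerf_functor_obj_single h i).finGenHom k 0).of_equivalence F).finite_homology)
    fun Y hY f => ?_
  have : (F.symm.inverse.obj Y).IsLE (b + (-b - 1)) := isLE_functor_obj h Y (-b - 1)
  have : F.symm.functor.Additive := inferInstanceAs F.inverse.Additive
  exact hom_functor_eq_zero F.symm (fun g => from_single_eq_zero g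
    ((isZero_of_isLE _ (b + (-b - 1)) 0 (by lia)).eq_zero_of_tgt _)) f

end Equivalence

end DerivedCategory

open Paper CategoryTheory in
/-- For a derived (triangulated) equivalence `F : D^b(A) → D^b(B)`,
`F(A)` is isomorphic to a complex of finitely generated projective `B`-modules
concentrated in degrees `0, …, n` if and only if `F⁻¹(B)` is isomorphic to a
complex of finitely generated projective `A`-modules concentrated in degrees
`-n, …, 0`. -/
theorem stmt12 (k : Type u) [CommRing k] [IsArtinianRing k]
    (A : Type u) [Ring A] [Algebra k A] [Module.Finite k A]
    (B : Type u) [Ring B] [Algebra k B] [Module.Finite k B]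
    [HasDerivedCategory.{u} (ModuleCat.{u} A)]
    [HasDerivedCategory.{u} (ModuleCat.{u} B)]
    (F : DerivedCategory (ModuleCat.{u} A) ≌ DerivedCategory (ModuleCat.{u} B))
    [F.functor.CommShift ℤ] [F.functor.IsTriangulated]
    (n : ℕ) :
    (∃ T : CochainComplex (ModuleCat.{u} B) ℤ,
      (∀ i, Module.Finite B (T.X i)) ∧ (∀ i, Module.Projective B (T.X i)) ∧
      (∀ i : ℤ, (i < 0 ∨ (n : ℤ) < i) → Subsingleton (T.X i)) ∧
      Nonempty (F.functor.obj
        ((DerivedCategory.singleFunctor (ModuleCat.{u} A) 0).obj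
          (ModuleCat.of A A)) ≅ DerivedCategory.Q.obj T)) ↔
    (∃ T : CochainComplex (ModuleCat.{u} A) ℤ,
      (∀ i, Module.Finite A (T.X i)) ∧ (∀ i, Module.Projective A (T.X i)) ∧
      (∀ i : ℤ, (i < -(n : ℤ) ∨ 0 < i) → Subsingleton (T.X i)) ∧
      Nonempty (F.inverse.obj
        ((DerivedCategory.singleFunctor (ModuleCat.{u} B) 0).obj
          (ModuleCat.of B B)) ≅ DerivedCategory.Q.obj T)) := by
  have : F.symm.functor.Additive := inferInstanceAs F.inverse.Additive
  let _ : F.symm.functor.CommShift ℤ := F.commShiftInverse ℤ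
  rw [← DerivedCategory.isPerf_iff, ← DerivedCategory.isPerf_iff]
  constructor
  · intro h
    exact (DerivedCategory.isPerf_inverse_obj h k (by lia)).mono le_rfl (by lia)
  · intro h
    exact (DerivedCategory.isPerf_inverse_obj (F := F.symm) h k (by lia)).mono
      (by lia) (by lia)
end

section
/- Let A be an Artin algebra with ed(A) = n, witnessed by A-mod = [T]_{n+1} for a module T. Set N := (⊕_{0 ≤ i ≤ n} Ω^i(T)) ⊕ A. Then for every finitely generated A-module X there is an exact sequence 0 → N_n → N_{n-1} → ⋯ → N_0 → X ⊕ X' → 0 with all N_i ∈ add(N); in particular N-wrd(A) ≤ n. -/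
universe u

open CategoryTheory

/-- A syzygy operator: `Syz M` is (up to isomorphism) the kernel of a projective
cover `P → M`, for every finitely generated module `M`. -/
def Paper.IsSyzygyOp (A : Type u) [Ring A]
    (Syz : ModuleCat.{u} A → ModuleCat.{u} A) : Prop :=
  ∀ M : ModuleCat.{u} A, Module.Finite A M →
    ∃ (P : ModuleCat.{u} A) (p : P →ₗ[A] M),
      Module.Finite A P ∧ Module.Projective A P ∧ Function.Surjective p ∧
      (∀ N : Submodule A P, N ⊔ LinearMap.ker p = ⊤ → N = ⊤) ∧
      Nonempty (Syz M ≃ₗ[A] LinearMap.ker p)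

namespace Paper

section Summands

variable {A : Type u} [Ring A]

/-- `M` is a retract (equivalently, a direct summand) of `N`. -/
def IsRetract (A : Type u) [Ring A] (M N : Type u) [AddCommGroup M] [Module A M]
    [AddCommGroup N] [Module A N] : Prop :=
  ∃ (s : M →ₗ[A] N) (r : N →ₗ[A] M), ∀ x, r (s x) = x

variable {M M' N N' L : Type u} [AddCommGroup M] [Module A M] [AddCommGroup M'] [Module A M']
  [AddCommGroup N] [Module A N] [AddCommGroup N'] [Module A N'] [AddCommGroup L] [Module A L]

theorem IsRetract.trans (h : IsRetract A M N) (h' : IsRetract A N L) : IsRetract A M L := by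
  obtain ⟨s, r, h⟩ := h
  obtain ⟨s', r', h'⟩ := h'
  exact ⟨s' ∘ₗ s, r ∘ₗ r', fun x => by simp [h, h']⟩

theorem IsRetract.of_equiv (e : M ≃ₗ[A] N) : IsRetract A M N :=
  ⟨e, e.symm, fun x => by simp⟩

theorem IsRetract.prodMap (h : IsRetract A M N) (h' : IsRetract A M' N') :
    IsRetract A (M × M') (N × N') := by
  obtain ⟨s, r, h⟩ := h
  obtain ⟨s', r', h'⟩ := h'
  exact ⟨s.prodMap s', r.prodMap r', fun x => by simp [h, h']⟩

theorem IsRetract.piMap (ι : Type) (h : IsRetract A M N) :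
    IsRetract A (ι → M) (ι → N) := by
  obtain ⟨s, r, h⟩ := h
  exact ⟨s.compLeft ι, r.compLeft ι, fun x => by ext i; simp [h]⟩

theorem IsRetract.of_finite_projective (P : Type u) [AddCommGroup P] [Module A P]
    [Module.Finite A P] [Module.Projective A P] :
    ∃ m : ℕ, IsRetract A P (Fin m → A) := by
  obtain ⟨m, f, g, -, -, h⟩ := Module.Finite.exists_comp_eq_id_of_projective A P
  exact ⟨m, g, f, fun x => LinearMap.congr_fun h x⟩

theorem mem_addOf_of_isRetract {X N : ModuleCat.{u} A} {ι : Type} [Finite ι]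
    (h : IsRetract A X (ι → N)) : X ∈ addOf A N := by
  obtain ⟨m, ⟨e⟩⟩ := Finite.exists_equiv_fin ι
  obtain ⟨s, r, h⟩ := h.trans (.of_equiv (LinearEquiv.funCongrLeft A N e.symm))
  refine ⟨m, fun _ => N, ModuleCat.of A (LinearMap.ker r), fun _ => rfl, ⟨?_⟩⟩
  have hsub : ∀ y, y - s (r y) ∈ LinearMap.ker r := fun y => by simp [h]
  exact LinearEquiv.ofLinearMap
    (s.coprod (LinearMap.ker r).subtype)
    (r.prod ((LinearMap.id - s ∘ₗ r).codRestrict (LinearMap.ker r) hsub))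
    (by ext1 y; simp)
    (by
      refine LinearMap.ext fun ⟨x, y, hy⟩ => ?_
      have hy' : r y = 0 := hy
      refine Prod.ext ?_ (Subtype.ext ?_) <;> simp [h, hy'])

theorem exists_prod_equiv_of_mem_addOf {X T : ModuleCat.{u} A} [Module.Finite A T]
    (h : X ∈ addOf A T) :
    ∃ (m : ℕ) (Y : ModuleCat.{u} A), Module.Finite A Y ∧
      Nonempty ((X × Y) ≃ₗ[A] (Fin m → T)) := by
  obtain ⟨m, M, Y, hM, ⟨e⟩⟩ := h
  obtain rfl : M = fun _ => T := funext hM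
  exact ⟨m, Y, .of_surjective (LinearMap.snd A X Y ∘ₗ e.symm.toLinearMap)
    (Prod.snd_surjective.comp e.symm.surjective), ⟨e⟩⟩

end Summands

section Filtrations

variable {A : Type u} [Ring A]

/-- `X` has a filtration of length `n + 1` whose subquotients are finite powers of `M`. -/
def IsPowFiltered (A : Type u) [Ring A] (M : Type u) [AddCommGroup M] [Module A M] :
    ℕ → ∀ (X : Type u) [AddCommGroup X] [Module A X], Prop
  | 0, X, _, _ => ∃ (ι : Type) (_ : Finite ι), Nonempty (X ≃ₗ[A] (ι → M))
  | n + 1, X, _, _ => ∃ (ι : Type) (_ : Finite ι) (W : ModuleCat.{u} A)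
      (f : (ι → M) →ₗ[A] X) (g : X →ₗ[A] W),
      Function.Injective f ∧ Function.Surjective g ∧ (∀ x, g x = 0 ↔ ∃ t, f t = x) ∧
        IsPowFiltered A M n W

variable {M K Q : Type u} [AddCommGroup M] [Module A M] [AddCommGroup K] [Module A K]
  [AddCommGroup Q] [Module A Q]

theorem IsPowFiltered.of_equiv {n : ℕ} {X Y : Type u} [AddCommGroup X] [Module A X]
    [AddCommGroup Y] [Module A Y] (e : X ≃ₗ[A] Y) (h : IsPowFiltered A M n X) :
    IsPowFiltered A M n Y := by
  cases n with
  | zero =>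
    obtain ⟨ι, hι, ⟨e'⟩⟩ := h
    exact ⟨ι, hι, ⟨e.symm.trans e'⟩⟩
  | succ n =>
    obtain ⟨ι, hι, W, f, g, hf, hg, hfg, hW⟩ := h
    refine ⟨ι, hι, W, e.toLinearMap ∘ₗ f, g ∘ₗ e.symm.toLinearMap, e.injective.comp hf,
      hg.comp e.symm.surjective, fun x => ?_, hW⟩
    simp [hfg, LinearEquiv.eq_symm_apply]

theorem IsPowFiltered.pi {n : ℕ} {κ : Type} [Finite κ] (X : κ → Type u)
    [∀ i, AddCommGroup (X i)] [∀ i, Module A (X i)] (h : ∀ i, IsPowFiltered A M n (X i)) :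
    IsPowFiltered A M n (∀ i, X i) := by
  induction n generalizing X with
  | zero =>
    choose ι hι e using h
    exact ⟨Σ i, ι i, inferInstance, ⟨(LinearEquiv.piCongrRight fun i => (e i).some).trans
      (LinearEquiv.piCurry A fun (i : κ) (_ : ι i) => M).symm⟩⟩
  | succ n ih =>
    choose ι hι W f g hf hg hfg hW using h
    let c := LinearEquiv.piCurry A fun (i : κ) (_ : ι i) => M
    refine ⟨Σ i, ι i, inferInstance, ModuleCat.of A (∀ i, W i),
      LinearMap.piMap f ∘ₗ c.toLinearMap, LinearMap.piMap g,
      (Function.Injective.piMap hf).comp c.injective, Function.Surjective.piMap hg,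
      fun x => ?_, ih (fun i => W i) hW⟩
    constructor
    · intro hx
      choose t ht using fun i => (hfg i (x i)).1 (congr_fun hx i)
      exact ⟨c.symm t, by ext i; simp [ht]⟩
    · rintro ⟨t, rfl⟩
      ext i
      exact (hfg i _).2 ⟨_, rfl⟩

/-- Every module in `[T]ₙ₊₁` is a direct summand of a module filtered by powers of `T`. -/
theorem exists_isPowFiltered_of_mem_bracket (T : ModuleCat.{u} A) [Module.Finite A T] (n : ℕ)
    (X : ModuleCat.{u} A) (hX : X ∈ bracket A T (n + 1)) :
    ∃ Y : ModuleCat.{u} A, Module.Finite A Y ∧ IsPowFiltered A T n (X × Y) := by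
  induction n generalizing X with
  | zero =>
    obtain ⟨m, Y, hY, e⟩ := exists_prod_equiv_of_mem_addOf hX
    exact ⟨Y, hY, Fin m, inferInstance, e⟩
  | succ n ih =>
    obtain ⟨m, V, R, hV, ⟨e⟩⟩ := hX
    choose hVfin T₁ T₂ f g hT₁ hT₂ hses using hV
    have hR : Module.Finite A R := .of_surjective (LinearMap.snd A X R ∘ₗ e.symm.toLinearMap)
      (Prod.snd_surjective.comp e.symm.surjective)
    choose p Y hY a using fun i => exists_prod_equiv_of_mem_addOf (hT₁ i)
    choose Z hZ hfil using fun i => ih (T₂ i) (hT₂ i)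
    have key : ∀ i, IsPowFiltered A T (n + 1) (V i × (Y i × Z i)) := by
      intro i
      obtain ⟨hf, hg, hfg⟩ := hses i
      have hfg' : ∀ x, g i x = 0 ↔ ∃ t, f i t = x := fun x => by
        rw [← LinearMap.mem_ker, ← hfg, LinearMap.mem_range]
      let b := (a i).some
      refine ⟨Fin (p i), inferInstance, ModuleCat.of A (T₂ i × Z i),
        ((f i).prodMap (LinearMap.inl A (Y i) (Z i))) ∘ₗ b.symm.toLinearMap,
        (g i).prodMap (LinearMap.snd A (Y i) (Z i)),
        (Function.Injective.prodMap hf LinearMap.inl_injective).comp b.symm.injective,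
        Function.Surjective.prodMap hg Prod.snd_surjective, ?_, hfil i⟩
      rintro ⟨v, y, z⟩
      constructor
      · intro h
        have h1 : g i v = 0 := congr_arg Prod.fst h
        have h2 : z = 0 := congr_arg Prod.snd h
        obtain ⟨t, rfl⟩ := (hfg' v).1 h1
        exact ⟨b (t, y), by simp [h2]⟩
      · rintro ⟨t, ht⟩
        have h1 : f i (b.symm t).1 = v := congr_arg Prod.fst ht
        have h2 : 0 = z := congr_arg (fun q => q.2.2) ht
        exact Prod.ext ((hfg' v).2 ⟨_, h1⟩) h2.symm
    refine ⟨ModuleCat.of A (R × ∀ i, Y i × Z i), inferInstanceAs (Module.Finite A (R × _)),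
      (IsPowFiltered.pi _ key).of_equiv ?_⟩
    let d : (∀ i, V i × (Y i × Z i)) ≃ₗ[A] (∀ i, V i) × (∀ i, Y i × Z i) :=
      { toFun := fun x => (fun i => (x i).1, fun i => (x i).2)
        invFun := fun x i => (x.1 i, x.2 i)
        map_add' := fun _ _ => rfl
        map_smul' := fun _ _ => rfl
        left_inv := fun _ => rfl
        right_inv := fun _ => rfl }
    exact (d.trans (e.symm.prodCongr (LinearEquiv.refl A _))).trans
      (LinearEquiv.prodAssoc A X R (∀ i, Y i × Z i))

/-- Horseshoe lemma: a presentation `0 → K → Q → M → 0` with `Q` finite projective induces, for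
each module `X` filtered by powers of `M`, a presentation whose kernel is filtered by powers
of `K`. -/
theorem IsPowFiltered.exists_presentation [Module.Finite A Q] [Module.Projective A Q]
    (j : K →ₗ[A] Q) (q : Q →ₗ[A] M) (hj : Function.Injective j) (hq : Function.Surjective q)
    (hjq : ∀ x, q x = 0 ↔ ∃ t, j t = x) {n : ℕ} {X : Type u} [AddCommGroup X] [Module A X]
    (h : IsPowFiltered A M n X) :
    ∃ (P : ModuleCat.{u} A) (p : P →ₗ[A] X), Module.Finite A P ∧ Module.Projective A P ∧
      Function.Surjective p ∧ IsPowFiltered A K n (LinearMap.ker p) := by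
  have hproj : ∀ (ι : Type) [Finite ι], Module.Projective A (ι → Q) := fun ι _ => by
    classical
    have := Fintype.ofFinite ι
    exact .of_equiv (DFinsupp.linearEquivFunOnFintype (R := A) (M := fun _ : ι => Q))
  have hpow : ∀ (ι : Type) (x : ι → Q), q.compLeft ι x = 0 ↔ ∃ t, j.compLeft ι t = x := by
    intro ι x
    constructor
    · intro hx
      choose t ht using fun i => (hjq (x i)).1 (congr_fun hx i)
      exact ⟨t, funext ht⟩
    · rintro ⟨t, rfl⟩
      exact funext fun i => (hjq _).2 ⟨t i, rfl⟩
  have hpowj : ∀ ι : Type, Function.Injective (j.compLeft ι) := fun ι => hj.comp_left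
  have hpowq : ∀ ι : Type, Function.Surjective (q.compLeft ι) := fun ι => hq.comp_left
  induction n generalizing X with
  | zero =>
    obtain ⟨ι, hι, ⟨e⟩⟩ := h
    have hker : ∀ x, (e.symm.toLinearMap ∘ₗ q.compLeft ι) x = 0 ↔ ∃ t, j.compLeft ι t = x :=
      fun x => by rw [← hpow]; simp
    refine ⟨ModuleCat.of A (ι → Q), e.symm.toLinearMap ∘ₗ q.compLeft ι,
      inferInstanceAs (Module.Finite A (ι → Q)), hproj ι, e.symm.surjective.comp (hpowq ι),
      ι, hι, ⟨?_⟩⟩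
    exact (LinearEquiv.ofBijective
      ((j.compLeft ι).codRestrict (LinearMap.ker (e.symm.toLinearMap ∘ₗ q.compLeft ι))
        fun t => (hker _).2 ⟨t, rfl⟩)
      ⟨fun s t hst => hpowj ι (congr_arg Subtype.val hst),
        fun ⟨x, hx⟩ => by
          obtain ⟨t, ht⟩ := (hker x).1 hx
          exact ⟨t, Subtype.ext ht⟩⟩).symm
  | succ n ih =>
    obtain ⟨ι, hι, W, f, g, hf, hg, hfg, hW⟩ := h
    obtain ⟨P, p, hPfin, hPproj, hp, hK⟩ := ih hW
    obtain ⟨l, hl⟩ := Module.projective_lifting_property g p hg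
    have hl' : ∀ x, g (l x) = p x := fun x => LinearMap.congr_fun hl x
    have hgf : ∀ t, g (f t) = 0 := fun t => (hfg _).2 ⟨t, rfl⟩
    have := hproj ι
    let p' : ((ι → Q) × P) →ₗ[A] X := (f ∘ₗ q.compLeft ι).coprod l
    have hp' : ∀ a x, p' (a, x) = f (q.compLeft ι a) + l x := fun a x => by simp [p']
    have hmem : ∀ y : LinearMap.ker p', y.1.2 ∈ LinearMap.ker p := by
      rintro ⟨⟨a, x⟩, hy⟩
      have := congr_arg g ((hp' a x).symm.trans hy)
      simpa [hgf, hl'] using this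
    have hmem' : ∀ t : ι → K, ((j.compLeft ι t, 0) : (ι → Q) × P) ∈ LinearMap.ker p' := by
      intro t
      rw [LinearMap.mem_ker, hp', (hpow ι _).2 ⟨t, rfl⟩]
      simp
    refine ⟨ModuleCat.of A ((ι → Q) × P), p',
      inferInstanceAs (Module.Finite A ((ι → Q) × P)),
      inferInstanceAs (Module.Projective A ((ι → Q) × P)), ?_,
      ι, hι, ModuleCat.of A (LinearMap.ker p),
      (LinearMap.inl A (ι → Q) P ∘ₗ j.compLeft ι).codRestrict (LinearMap.ker p') hmem',
      (LinearMap.snd A (ι → Q) P ∘ₗ (LinearMap.ker p').subtype).codRestrict _ hmem,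
      ?_, ?_, ?_, hK⟩
    · intro x
      obtain ⟨y, hy⟩ := hp (g x)
      obtain ⟨t, ht⟩ := (hfg (x - l y)).1 (by rw [map_sub, hl', hy, sub_self])
      obtain ⟨a, rfl⟩ := hpowq ι t
      exact ⟨(a, y), by rw [hp', ht, sub_add_cancel]⟩
    · intro s t hst
      exact hpowj ι (congr_arg (fun z => z.1.1) hst)
    · rintro ⟨x, hx⟩
      obtain ⟨t, ht⟩ := (hfg (l x)).1 (by rw [hl']; exact hx)
      obtain ⟨a, rfl⟩ := hpowq ι t
      refine ⟨⟨(-a, x), ?_⟩, rfl⟩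
      rw [LinearMap.mem_ker, hp', ← ht, map_neg, map_neg, neg_add_cancel]
    · rintro ⟨⟨a, x⟩, hy⟩
      constructor
      · intro h
        obtain rfl : x = 0 := congr_arg Subtype.val h
        have h0 : f (q.compLeft ι a) = 0 := by
          have := (hp' a 0).symm.trans hy
          rwa [map_zero, add_zero] at this
        obtain ⟨t, rfl⟩ := (hpow ι a).1 (hf (h0.trans (map_zero f).symm))
        exact ⟨t, rfl⟩
      · rintro ⟨t, ht⟩
        exact Subtype.ext (congr_arg (fun z => z.1.2) ht).symm

end Filtrations

section Resolutions

variable {A : Type u} [Ring A]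

theorem IsSyzygyOp.finite_iterate [IsNoetherianRing A] {Syz : ModuleCat.{u} A → ModuleCat.{u} A}
    (hSyz : IsSyzygyOp A Syz) (T : ModuleCat.{u} A) [hT : Module.Finite A T] (i : ℕ) :
    Module.Finite A (Syz^[i] T) := by
  induction i with
  | zero => exact hT
  | succ i ih =>
    rw [Function.iterate_succ_apply']
    obtain ⟨P, p, hP, -, -, -, ⟨e⟩⟩ := hSyz _ ih
    exact .equiv e.symm

/-- A module filtered by `n + 1` powers of `Ω^i(T)` is resolved by `Ω^i(T), …, Ω^{i+n}(T)` and
projectives. -/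
theorem IsSyzygyOp.resLen [IsNoetherianRing A] {Syz : ModuleCat.{u} A → ModuleCat.{u} A}
    (hSyz : IsSyzygyOp A Syz) (T : ModuleCat.{u} A) [Module.Finite A T] (N : ModuleCat.{u} A)
    (hA : IsRetract A A N) (n i : ℕ) (hN : ∀ j ≤ i + n, IsRetract A (Syz^[j] T) N)
    (X : ModuleCat.{u} A) (hX : IsPowFiltered A (Syz^[i] T) n X) : ResLen A N X n := by
  induction n generalizing i X with
  | zero =>
    obtain ⟨ι, hι, ⟨e⟩⟩ := hX
    exact mem_addOf_of_isRetract ((IsRetract.of_equiv e).trans ((hN i le_rfl).piMap ι))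
  | succ n ih =>
    obtain ⟨ι, hι, W, f, g, hf, hg, hfg, hW⟩ := hX
    obtain ⟨Q, q, hQ, hQ', hq, -, ⟨e⟩⟩ := hSyz _ (hSyz.finite_iterate T i)
    obtain ⟨P, p, hP, hP', hp, hK⟩ := hW.exists_presentation
      ((LinearMap.ker q).subtype ∘ₗ e.toLinearMap) q
      (Subtype.val_injective.comp e.injective) hq
      (fun x => ⟨fun hx => ⟨e.symm ⟨x, hx⟩, by simp⟩, by rintro ⟨t, rfl⟩; exact (e t).2⟩)
    obtain ⟨l, hl⟩ := Module.projective_lifting_property g p hg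
    have hl' : ∀ x, g (l x) = p x := fun x => LinearMap.congr_fun hl x
    have hgf : ∀ t, g (f t) = 0 := fun t => (hfg _).2 ⟨t, rfl⟩
    obtain ⟨m, hm⟩ := IsRetract.of_finite_projective (A := A) P
    have hadd : ModuleCat.of A ((ι → Syz^[i] T) × P) ∈ addOf A N :=
      mem_addOf_of_isRetract (ι := ι ⊕ Fin m)
        ((((hN i (by omega)).piMap ι).prodMap (hm.trans (hA.piMap (Fin m)))).trans
          (.of_equiv (LinearEquiv.sumArrowLequivProdArrow ι (Fin m) A N).symm))
    let r : ((ι → Syz^[i] T) × P) →ₗ[A] X := f.coprod l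
    have hr : ∀ t x, r (t, x) = f t + l x := fun t x => by simp [r]
    have hmem : ∀ y : LinearMap.ker r, y.1.2 ∈ LinearMap.ker p := by
      rintro ⟨⟨t, x⟩, hy⟩
      have := congr_arg g ((hr t x).symm.trans hy)
      simpa [hgf, hl'] using this
    refine ⟨ModuleCat.of A ((ι → Syz^[i] T) × P), r, hadd, ?_,
      ih (i + 1) (fun j hj => hN j (by omega)) _ ?_⟩
    · intro x
      obtain ⟨y, hy⟩ := hp (g x)
      obtain ⟨t, ht⟩ := (hfg (x - l y)).1 (by rw [map_sub, hl', hy, sub_self])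
      exact ⟨(t, y), by rw [hr, ht, sub_add_cancel]⟩
    · rw [Function.iterate_succ_apply']
      refine hK.of_equiv (LinearEquiv.ofBijective
        ((LinearMap.snd A _ P ∘ₗ (LinearMap.ker r).subtype).codRestrict _ hmem) ⟨?_, ?_⟩).symm
      · rw [injective_iff_map_eq_zero]
        rintro ⟨⟨t, x⟩, hy⟩ h
        obtain rfl : x = 0 := congr_arg Subtype.val h
        have h0 : f t = 0 := by
          have := (hr t 0).symm.trans hy
          rwa [map_zero, add_zero] at this
        obtain rfl : t = 0 := hf (h0.trans (map_zero f).symm)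
        rfl
      · rintro ⟨x, hx⟩
        obtain ⟨t, ht⟩ := (hfg (l x)).1 (by rw [hl']; exact hx)
        refine ⟨⟨(-t, x), ?_⟩, rfl⟩
        rw [LinearMap.mem_ker, hr, map_neg, ht, neg_add_cancel]

end Resolutions

end Paper

open Paper in
/-- If `ed(A) = n` is witnessed by `A-mod = [T]_{n+1}`, then for
`N := (⊕_{0 ≤ i ≤ n} Ω^i(T)) ⊕ A` every finitely generated `X` admits an exact
sequence `0 → N_n → ⋯ → N_0 → X ⊕ X' → 0` with all `N_i ∈ add N`; in particular
`N`-wrd(A) ≤ n. -/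
theorem stmt17 (k : Type u) [CommRing k] [IsArtinianRing k]
    (A : Type u) [Ring A] [Algebra k A] [Module.Finite k A]
    (Syz : ModuleCat.{u} A → ModuleCat.{u} A) (hSyz : IsSyzygyOp A Syz)
    (n : ℕ) (T : ModuleCat.{u} A) (hT : Module.Finite A T)
    (hwit : ∀ X : ModuleCat.{u} A, Module.Finite A X → X ∈ bracket A T (n + 1))
    (N : ModuleCat.{u} A)
    (hN : N = ModuleCat.of A (((i : Fin (n+1)) → (Syz^[i.1] T : Type u)) × A)) :
    (∀ X : ModuleCat.{u} A, Module.Finite A X → wrdLE A N X n) ∧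
      wrdAlg A N ≤ (n : ℕ∞) := by
  have : IsNoetherianRing A := isNoetherian_of_tower k inferInstance
  have main : ∀ X : ModuleCat.{u} A, Module.Finite A X → wrdLE A N X n := by
    intro X hX
    obtain ⟨Y, hY, hfil⟩ := exists_isPowFiltered_of_mem_bracket T n X (hwit X hX)
    subst hN
    refine ⟨Y, hY, hSyz.resLen T _ ⟨LinearMap.inr A _ A, LinearMap.snd A _ A, fun _ => rfl⟩ n 0
      (fun j hj => ?_) _ hfil⟩
    have hj' : j < n + 1 := by omega
    exact ⟨LinearMap.inl A _ A ∘ₗ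
        LinearMap.single A (fun i : Fin (n + 1) => (Syz^[i.1] T : Type u)) ⟨j, hj'⟩,
      LinearMap.proj (φ := fun i : Fin (n + 1) => (Syz^[i.1] T : Type u)) ⟨j, hj'⟩ ∘ₗ
        LinearMap.fst A _ A, fun x => by simp⟩
  refine ⟨main, sSup_le ?_⟩
  rintro _ ⟨X, hX, rfl⟩
  exact sInf_le ⟨n, rfl, main X hX⟩
end
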